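/- Ultrafilter pullbacks: Suppose λ is an infinite cardinal, B0 is a complete Boolean algebra with an antichain of cardinality λ, and B1 is a complete Boolean algebra such that 2^κ ≤ 2^λ for every cardinal κ < c.c.(B1). Suppose U1 is an ultrafilter on B1. Then there is a λ-regular ultrafilter U0 on B0 such that for every complete countable first-order theory T, U0 λ⁺-saturates T if and only if U1 λ⁺-saturates T. -/

import Mathlib

open FirstOrder FirstOrder.Language Cardinal

namespace BVal

/-! ### Filters and ultrafilters on complete Boolean algebras -/

variable {B : Type} [CompleteBooleanAlgebra B]

/-- A filter on a complete Boolean algebra. -/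
def IsBFilter (D : Set B) : Prop :=
  ⊤ ∈ D ∧ ⊥ ∉ D ∧ (∀ a b : B, a ∈ D → a ≤ b → b ∈ D) ∧
    (∀ a b : B, a ∈ D → b ∈ D → a ⊓ b ∈ D)

/-- An ultrafilter on a complete Boolean algebra. -/
def IsBUltrafilter (U : Set B) : Prop :=
  IsBFilter U ∧ ∀ a : B, a ∈ U ∨ aᶜ ∈ U

/-- An antichain in a complete Boolean algebra: pairwise disjoint nonzero elements. -/
def IsBAntichain (S : Set B) : Prop :=
  (∀ a ∈ S, a ≠ ⊥) ∧ S.Pairwise fun a b => a ⊓ b = ⊥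

/-- `ccOf B` is the least cardinal `κ` such that every antichain of `B` has cardinality `< κ`. -/
noncomputable def ccOf (B : Type) [CompleteBooleanAlgebra B] : Cardinal :=
  sInf {κ : Cardinal | ∀ S : Set B, IsBAntichain S → Cardinal.mk S < κ}

/-! ### Regularity -/

/-- An `I`-quasiregular family: finite meets are nonzero, countably infinite meets are zero. -/
def IsQuasiregularFamily {I : Type} (a : I → B) : Prop :=
  (∀ s : Finset I, s.inf a ≠ ⊥) ∧
    ∀ J : Set I, J.Countable → J.Infinite → (⨅ i ∈ J, a i) = ⊥

/-- An `I`-regular family: quasiregular, and the set of nonzero elements deciding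
every member of the family is dense. -/
def IsRegularFamily {I : Type} (a : I → B) : Prop :=
  IsQuasiregularFamily a ∧
    ∀ b : B, b ≠ ⊥ → ∃ b' : B, b' ≠ ⊥ ∧ b' ≤ b ∧ ∀ i, b' ≤ a i ∨ b' ≤ (a i)ᶜ

/-- A filter `D` is `lam`-regular if it contains some `lam`-regular family. -/
def IsRegularFilter (D : Set B) (lam : Cardinal) : Prop :=
  ∃ a : Quotient.out lam → B, IsRegularFamily a ∧ ∀ α, a α ∈ D

/-! ### Boolean-valued structures -/

/-- Plug the tuple `b` into the `Fin`-indexed free variables of the bounded formula `φ`,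
relabelling the parameters along `e`. -/
def plugEmb {L : FirstOrder.Language.{0, 0}} {C D : Type} {k : ℕ} (φ : L.BoundedFormula C k)
    (e : C → D) (b : Fin k → D) : L.Formula D :=
  φ.toFormula.relabel (Sum.elim e b)

/-- Plug the tuple `b` into the `Fin`-indexed free variables of the bounded formula `φ`. -/
def plug {L : FirstOrder.Language.{0, 0}} {C : Type} {k : ℕ} (φ : L.BoundedFormula C k)
    (b : Fin k → C) : L.Formula C :=
  plugEmb φ id b

/-- The finite conjunction of a list of bounded formulas. -/
def listConj {L : FirstOrder.Language.{0, 0}} {α : Type} {n : ℕ} :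
    List (L.BoundedFormula α n) → L.BoundedFormula α n
  | [] => ⊤
  | φ :: l => φ ⊓ listConj l

/-- The axioms for a `B`-valued `L`-structure with carrier `C` and evaluation map `val`,
where formulas with parameters from `C` are encoded as `L.Formula C` (the parameters being
the free variables): logically valid formulas get value `⊤`, negation and conjunction are
respected, the value of an existential formula is the supremum of the values of its instances,
and distinct elements are not identified. -/
def IsBVal {L : FirstOrder.Language.{0, 0}} {C : Type} (val : L.Formula C → B) : Prop :=
  (∀ φ : L.Formula C,
      (∀ (N : Type) [L.Structure N] [Nonempty N] (v : C → N), φ.Realize v) → val φ = ⊤) ∧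
  (∀ φ : L.Formula C, val φ.not = (val φ)ᶜ) ∧
  (∀ φ ψ : L.Formula C, val (φ ⊓ ψ) = val φ ⊓ val ψ) ∧
  (∀ φ : L.BoundedFormula C 1, val φ.ex = ⨆ a : C, val (plug φ fun _ => a)) ∧
  (∀ a b : C, a ≠ b → val (Term.equal (Term.var a) (Term.var b)) < ⊤)

/-- Fullness of a `B`-valued structure: every existential value is attained. -/
def IsFull {L : FirstOrder.Language.{0, 0}} {C : Type} (val : L.Formula C → B) : Prop :=
  ∀ φ : L.BoundedFormula C 1, ∃ a : C, val φ.ex = val (plug φ fun _ => a)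

/-- The `B`-valued structure gives every sentence of `T` the value `⊤`. -/
def BModels {L : FirstOrder.Language.{0, 0}} {C : Type} (val : L.Formula C → B) (T : L.Theory) : Prop :=
  ∀ φ ∈ T, val (Formula.relabel (fun e : Empty => e.elim) φ) = ⊤

/-- `val` is a full `B`-valued model of `T`. -/
def IsFullBModel {L : FirstOrder.Language.{0, 0}} (T : L.Theory) {C : Type}
    (val : L.Formula C → B) : Prop :=
  IsBVal val ∧ IsFull val ∧ BModels val T

/-- An elementary map between `B`-valued structures. -/
def ElemMap {L : FirstOrder.Language.{0, 0}} {C D : Type} (v : L.Formula C → B) (w : L.Formula D → B)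
    (f : C → D) : Prop :=
  ∀ φ : L.Formula C, v φ = w (φ.relabel f)

/-- `lam⁺`-saturation for full `B`-valued models of `T`: elementary maps from models of
cardinality at most `lam` extend along elementary extensions. -/
def BSaturated {L : FirstOrder.Language.{0, 0}} (T : L.Theory) (lam : Cardinal) {C : Type}
    (val : L.Formula C → B) : Prop :=
  ∀ (C0 C1 : Type) (v0 : L.Formula C0 → B) (v1 : L.Formula C1 → B),
    IsFullBModel T v0 → IsFullBModel T v1 → Cardinal.mk C1 ≤ lam →
    ∀ ι : C0 → C1, ElemMap v0 v1 ι →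
    ∀ f : C0 → C, ElemMap v0 val f →
    ∃ g : C1 → C, ElemMap v1 val g ∧ g ∘ ι = f

/-- `lam⁺`-universality for full `B`-valued models of `T`. -/
def BUniversal {L : FirstOrder.Language.{0, 0}} (T : L.Theory) (lam : Cardinal) {C : Type}
    (val : L.Formula C → B) : Prop :=
  ∀ (C1 : Type) (v1 : L.Formula C1 → B), IsFullBModel T v1 → Cardinal.mk C1 ≤ lam →
    ∃ f : C1 → C, ElemMap v1 val f

/-! ### Ordinary structures, specializations, ordinary saturation -/

/-- A bundled (nonempty) ordinary `L`-structure. -/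
structure OrdStructure (L : FirstOrder.Language.{0, 0}) : Type 1 where
  carrier : Type
  [str : L.Structure carrier]
  [nonempty' : Nonempty carrier]

attribute [instance] OrdStructure.str OrdStructure.nonempty'

instance {L : FirstOrder.Language.{0, 0}} : CoeSort (OrdStructure L) Type :=
  ⟨OrdStructure.carrier⟩

/-- `(N, π)` is a specialization of the `B`-valued structure `val` at the ultrafilter `U`:
`π` is surjective and a formula holds in `N` of the images iff its value lies in `U`. -/
def IsSpecialization {L : FirstOrder.Language.{0, 0}} {C : Type} (val : L.Formula C → B) (U : Set B)
    (N : Type) [L.Structure N] (π : C → N) : Prop :=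
  Function.Surjective π ∧ ∀ φ : L.Formula C, (val φ ∈ U ↔ φ.Realize π)

/-- An ordinary structure `N` is `lam⁺`-saturated: every finitely satisfiable set of formulas
in one free variable with parameters from a subset of `N` of cardinality at most `lam`
is realized in `N`. -/
def OrdSaturated (L : FirstOrder.Language.{0, 0}) (lam : Cardinal) (N : Type) [L.Structure N] : Prop :=
  ∀ A : Set N, Cardinal.mk A ≤ lam →
    ∀ p : Set (L.BoundedFormula A 1),
      (∀ s : Finset (L.BoundedFormula A 1), ↑s ⊆ p →
        ∃ b : N, ∀ φ ∈ s, BoundedFormula.Realize φ Subtype.val fun _ => b) →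
      ∃ b : N, ∀ φ ∈ p, BoundedFormula.Realize φ Subtype.val fun _ => b

/-- The ultrafilter `U` on `B` `lam⁺`-saturates the theory `T`: for every `lam⁺`-saturated
full `B`-valued model of `T`, every specialization at `U` is `lam⁺`-saturated. -/
def Saturates {L : FirstOrder.Language.{0, 0}} (U : Set B) (T : L.Theory) (lam : Cardinal) : Prop :=
  ∀ (C : Type) (val : L.Formula C → B), IsFullBModel T val → BSaturated T lam val →
    ∀ (N : Type) [L.Structure N] (π : C → N), IsSpecialization val U N π →
      OrdSaturated L lam N

/-! ### Distributions -/

/-- An `I`-distribution in `B`. -/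
def IsDistribution {I : Type} (A : Finset I → B) : Prop :=
  A ∅ = ⊤ ∧ (∀ s, A s ≠ ⊥) ∧ ∀ s t : Finset I, s ⊆ t → A t ≤ A s

/-- A multiplicative distribution. -/
def MultiplicativeDist {I : Type} (A : Finset I → B) : Prop :=
  ∀ s : Finset I, A s = s.inf fun i => A {i}

/-- `A'` refines `A`. -/
def Refines {I : Type} (A' A : Finset I → B) : Prop :=
  ∀ s, A' s ≤ A s

/-- `A'` conservatively refines `A`. -/
def ConsRefines {I : Type} (A' A : Finset I → B) : Prop :=
  ∀ s : Finset I, A' s = A s ⊓ s.inf fun i => A' {i}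

/-- The distribution `A` lies in the filter `D`. -/
def InFilter {I : Type} (A : Finset I → B) (D : Set B) : Prop :=
  ∀ s, A s ∈ D

/-- `A` has a multiplicative refinement in `D`. -/
def HasMultRefinement {I : Type} (A : Finset I → B) (D : Set B) : Prop :=
  ∃ A' : Finset I → B, IsDistribution A' ∧ MultiplicativeDist A' ∧ InFilter A' D ∧ Refines A' A

/-- A filter `D` is `lam⁺`-good if every `lam`-distribution in `D` has a multiplicative
refinement in `D`. -/
def IsGoodFilter (D : Set B) (lam : Cardinal) : Prop :=
  ∀ A : Finset (Quotient.out lam) → B, IsDistribution A → InFilter A D →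
    HasMultRefinement A D

/-- A distribution is regular if the family of its values at singletons is regular. -/
def IsRegularDistribution {I : Type} (A : Finset I → B) : Prop :=
  IsRegularFamily fun i => A {i}

/-! ### Łoś maps and possibilities -/

/-- An `I`-sequence of formulas `φ_i(x̄, ȳ_i)`: `x̄` has length `n`, `ȳ_i` has length `m i`. -/
structure FormulaSeq (L : FirstOrder.Language.{0, 0}) (I : Type) : Type 1 where
  n : ℕ
  m : I → ℕ
  φ : ∀ i, L.Formula (Fin n ⊕ Fin (m i))

/-- The formula `∃ x̄, ⋀_{i ∈ s} φ_i(x̄, ā_i)`, with parameters `a`. -/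
noncomputable def losFormula {L : FirstOrder.Language.{0, 0}} {C I : Type} (Φ : FormulaSeq L I)
    (a : ∀ i, Fin (Φ.m i) → C) (s : Finset I) : L.Formula C :=
  BoundedFormula.exs (listConj (s.toList.map fun i =>
    BoundedFormula.relabel
      (fun v : Fin Φ.n ⊕ Fin (Φ.m i) =>
        Sum.elim (fun k => Sum.inr k) (fun j => Sum.inl (a i j)) v)
      (Φ.φ i)))

/-- `A` is a `(I, T, Φ)`-Łoś map. -/
def IsLosMapFor {L : FirstOrder.Language.{0, 0}} (T : L.Theory) {I : Type} (A : Finset I → B)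
    (Φ : FormulaSeq L I) : Prop :=
  ∃ (C : Type) (val : L.Formula C → B), IsFullBModel T val ∧
    ∃ a : ∀ i, Fin (Φ.m i) → C, ∀ s : Finset I, A s = val (losFormula Φ a s)

/-- `A` is a `(I, T)`-Łoś map. -/
def IsLosMap {L : FirstOrder.Language.{0, 0}} (T : L.Theory) {I : Type} (A : Finset I → B) : Prop :=
  ∃ Φ : FormulaSeq L I, IsLosMapFor T A Φ

/-- `A` is a `(I, T)`-Łoś map witnessed by a formula sequence whose `x̄` has length `k`. -/
def IsLosMapOfArity {L : FirstOrder.Language.{0, 0}} (T : L.Theory) {I : Type} (A : Finset I → B)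
    (k : ℕ) : Prop :=
  ∃ Φ : FormulaSeq L I, Φ.n = k ∧ IsLosMapFor T A Φ

/-- `A` is a `(I, T)`-possibility: it conservatively refines some `(I, T)`-Łoś map. -/
def IsPossibility {L : FirstOrder.Language.{0, 0}} (T : L.Theory) {I : Type} (A : Finset I → B) : Prop :=
  ∃ A0 : Finset I → B, IsDistribution A0 ∧ IsLosMap T A0 ∧ ConsRefines A A0

/-! ### Partial types -/

/-- `p` is a partial type over the `B`-valued structure `val`: each finite conjunction has
nonzero existential value. -/
def IsPartialType {L : FirstOrder.Language.{0, 0}} {C : Type} (val : L.Formula C → B) {k : ℕ}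
    (p : Set (L.BoundedFormula C k)) : Prop :=
  ∀ Γ : Finset (L.BoundedFormula C k), ↑Γ ⊆ p →
    val (BoundedFormula.exs (listConj Γ.toList)) ≠ ⊥

/-- `p` is a partial `U`-type over `val`: each finite conjunction has existential value in `U`. -/
def IsUType {L : FirstOrder.Language.{0, 0}} {C : Type} (val : L.Formula C → B) (U : Set B) {k : ℕ}
    (p : Set (L.BoundedFormula C k)) : Prop :=
  ∀ Γ : Finset (L.BoundedFormula C k), ↑Γ ⊆ p →
    val (BoundedFormula.exs (listConj Γ.toList)) ∈ U

/-- The Łoś map of the partial type `p`, as a `p`-distribution. -/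
noncomputable def losOfType {L : FirstOrder.Language.{0, 0}} {C : Type} (val : L.Formula C → B) {k : ℕ}
    (p : Set (L.BoundedFormula C k)) : Finset ↥p → B := fun Γ =>
  val (BoundedFormula.exs (listConj (Γ.toList.map Subtype.val)))

/-! ### Boolean ultrapowers -/

/-- The carrier of the Boolean ultrapower `M^B`: maximal antichains indexed by `M`. -/
def BUP (B : Type) [CompleteBooleanAlgebra B] (M : Type) : Type :=
  {a : M → B // (∀ m m' : M, m ≠ m' → a m ⊓ a m' = ⊥) ∧ (⨆ m, a m) = ⊤}

/-- The evaluation map of the Boolean ultrapower `M^B`. -/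
noncomputable def bupVal (B : Type) [CompleteBooleanAlgebra B] {L : FirstOrder.Language.{0, 0}}
    (M : Type) [L.Structure M] : L.Formula (BUP B M) → B := fun φ =>
  letI : DecidableEq (BUP B M) := Classical.decEq _
  ⨆ (w : BUP B M → M) (_ : φ.Realize w), φ.freeVarFinset.inf fun c => c.1 (w c)

/-- A bundled complete Boolean algebra. -/
structure CBA : Type 1 where
  carrier : Type
  [str : CompleteBooleanAlgebra carrier]

attribute [instance] CBA.str

instance : CoeSort CBA Type := ⟨CBA.carrier⟩

end BVal

open BVal

namespace UPB

/-- Boolean homomorphisms as plain functions. -/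
structure IsHom {E : Type*} {B : Type*} [BooleanAlgebra E] [BooleanAlgebra B] (F : E → B) : Prop where
  inf : ∀ x y, F (x ⊓ y) = F x ⊓ F y
  compl : ∀ x, F xᶜ = (F x)ᶜ
  top : F ⊤ = ⊤

namespace IsHom
variable {E : Type*} {B : Type*} [BooleanAlgebra E] [BooleanAlgebra B] {F : E → B}

theorem bot (h : IsHom F) : F ⊥ = ⊥ := by
  rw [← compl_top, h.compl, h.top, compl_top]

theorem mono (h : IsHom F) {x y : E} (hxy : x ≤ y) : F x ≤ F y := by
  rw [← inf_eq_left.mpr hxy, h.inf]; exact inf_le_right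

theorem finset_inf (h : IsHom F) {ι : Type*} (s : Finset ι) (a : ι → E) :
    F (s.inf a) = s.inf fun i => F (a i) := by
  classical
  induction s using Finset.induction_on with
  | empty => simp [h.top]
  | insert i s hi ih => rw [Finset.inf_insert, Finset.inf_insert, h.inf, ih]

theorem comp {E' : Type*} [BooleanAlgebra E'] {G : E' → E} (h : IsHom F) (hG : IsHom G) :
    IsHom fun x => F (G x) :=
  ⟨fun x y => by rw [hG.inf, h.inf], fun x => by rw [hG.compl, h.compl], by rw [hG.top, h.top]⟩

theorem eq_of_le (h : IsHom F) {x : E} {b : B} (h1 : b ≤ F x) (h2 : bᶜ ≤ F xᶜ) : F x = b := by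
  apply le_antisymm _ h1
  rw [h.compl] at h2
  exact compl_le_compl_iff_le.mp h2

end IsHom

/-- Meet-closed consistent sets of lower bound constraints. -/
structure Good {E : Type*} {B : Type*} [BooleanAlgebra E] [BooleanAlgebra B] (R : Set (E × B)) : Prop where
  top : (⊤, ⊤) ∈ R
  inf : ∀ x y x' y', (x, y) ∈ R → (x', y') ∈ R → (x ⊓ x', y ⊓ y') ∈ R
  bot : ∀ b, (⊥, b) ∈ R → b = ⊥

/-- Sikorski's extension theorem, in constraint form. -/
theorem sik {E : Type*} {B : Type*} [BooleanAlgebra E] [CompleteBooleanAlgebra B] (R : Set (E × B))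
    (hR : Good R) : ∃ F : E → B, IsHom F ∧ ∀ x y, (x, y) ∈ R → y ≤ F x := by
  obtain ⟨M, hRM, hM⟩ := zorn_subset_nonempty {R : Set (E × B) | Good R} (by
    intro c hc hch hne
    refine ⟨⋃₀ c, ⟨?_, ?_, ?_⟩, fun s hs => Set.subset_sUnion_of_mem hs⟩
    · obtain ⟨r, hr⟩ := hne
      exact ⟨r, hr, (hc hr).top⟩
    · rintro x y x' y' ⟨r, hr, h1⟩ ⟨r', hr', h2⟩
      rcases hch.total hr hr' with h | h
      · exact ⟨r', hr', (hc hr').inf _ _ _ _ (h h1) h2⟩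
      · exact ⟨r, hr, (hc hr).inf _ _ _ _ h1 (h h2)⟩
    · rintro b ⟨r, hr, h1⟩
      exact (hc hr).bot b h1) R hR
  have hG : Good M := hM.prop
  have key : ∀ e b, (∀ x y, (x, y) ∈ M → x ⊓ e = ⊥ → y ⊓ b = ⊥) → (e, b) ∈ M := by
    intro e b h
    have hg : Good (M ∪ {p | ∃ x y, (x, y) ∈ M ∧ p = (x ⊓ e, y ⊓ b)}) := by
      refine ⟨Or.inl hG.top, ?_, ?_⟩
      · rintro x y x' y' (h1 | ⟨u, v, h1, h1'⟩) (h2 | ⟨u', v', h2, h2'⟩)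
        · exact Or.inl (hG.inf _ _ _ _ h1 h2)
        · obtain ⟨rfl, rfl⟩ := Prod.mk.inj h2'
          exact Or.inr ⟨_, _, hG.inf _ _ _ _ h1 h2, by simp [inf_assoc]⟩
        · obtain ⟨rfl, rfl⟩ := Prod.mk.inj h1'
          exact Or.inr ⟨_, _, hG.inf _ _ _ _ h1 h2, by
            rw [inf_right_comm, inf_right_comm (a := v)]⟩
        · obtain ⟨rfl, rfl⟩ := Prod.mk.inj h1'
          obtain ⟨rfl, rfl⟩ := Prod.mk.inj h2'
          exact Or.inr ⟨_, _, hG.inf _ _ _ _ h1 h2, by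
            rw [← inf_inf_distrib_right, ← inf_inf_distrib_right]⟩
      · rintro y (h1 | ⟨u, v, h1, h1'⟩)
        · exact hG.bot _ h1
        · obtain ⟨h3, rfl⟩ := Prod.mk.inj h1'
          exact h _ _ h1 h3.symm
    have := hM.le_of_ge hg Set.subset_union_left
    exact this (Or.inr ⟨⊤, ⊤, hG.top, by simp⟩)
  let F : E → B := fun e => sSup {b | (e, b) ∈ M}
  have hF : ∀ e, (e, F e) ∈ M := by
    intro e
    apply key
    intro x y hxy hxe
    show y ⊓ sSup _ = ⊥
    rw [inf_sSup_eq]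
    simp only [iSup_eq_bot]
    intro b hb
    have := hG.inf _ _ _ _ hxy hb
    rw [hxe] at this
    exact hG.bot _ this
  have hle : ∀ e b, (e, b) ∈ M → b ≤ F e := fun e b h => le_sSup h
  have hup : ∀ e e' b, (e, b) ∈ M → e ≤ e' → (e', b) ∈ M := by
    intro e e' b h hee
    apply key
    intro x y hxy hx
    have := hG.inf _ _ _ _ hxy h
    have h0 : x ⊓ e = ⊥ := by
      rw [eq_bot_iff, ← hx]; exact inf_le_inf_left _ hee
    rw [h0] at this
    exact hG.bot _ this
  have hmono : ∀ e e', e ≤ e' → F e ≤ F e' := fun e e' h => hle _ _ (hup _ _ _ (hF e) h)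
  have hinf : ∀ e e', F (e ⊓ e') = F e ⊓ F e' := fun e e' =>
    le_antisymm (le_inf (hmono _ _ inf_le_left) (hmono _ _ inf_le_right))
      (hle _ _ (hG.inf _ _ _ _ (hF e) (hF e')))
  have hbot : F ⊥ = ⊥ := hG.bot _ (hF ⊥)
  refine ⟨F, ⟨hinf, ?_, top_le_iff.mp (hle _ _ hG.top)⟩, fun x y h => hle _ _ (hRM h)⟩
  intro e
  apply le_antisymm
  · rw [le_compl_iff_disjoint_right, disjoint_iff, ← hinf, compl_inf_eq_bot, hbot]
  · apply hle
    apply key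
    intro x y hxy hx
    have : x ≤ e := by
      rw [← compl_compl e, le_compl_iff_disjoint_right, disjoint_iff]; exact hx
    have := hle _ _ (hup _ _ _ hxy this)
    rw [← le_bot_iff, ← inf_compl_eq_bot (a := F e)]
    exact inf_le_inf_right _ this

/-- Every nonzero element lies in a (Prop-valued) ultrafilter. -/
theorem exists_ult {B : Type} [CompleteBooleanAlgebra B] (b : B) (hb : b ≠ ⊥) :
    ∃ V : Set B, IsBUltrafilter V ∧ b ∈ V := by
  obtain ⟨F, hF, h⟩ := sik (E := B) (B := Prop) ({(⊤, ⊤), (b, ⊤)}) (by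
    refine ⟨by simp, ?_, ?_⟩
    · intro x y x' y' h1 h2
      simp only [Set.mem_insert_iff, Set.mem_singleton_iff, Prod.mk.injEq] at h1 h2 ⊢
      rcases h1 with ⟨rfl, rfl⟩ | ⟨rfl, rfl⟩ <;> rcases h2 with ⟨rfl, rfl⟩ | ⟨rfl, rfl⟩ <;> simp
    · intro c h1
      simp only [Set.mem_insert_iff, Set.mem_singleton_iff, Prod.mk.injEq] at h1
      rcases h1 with ⟨h, -⟩ | ⟨h, -⟩
      · exact absurd (eq_bot_of_bot_eq_top h b) hb
      · exact absurd h.symm hb)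
  refine ⟨{x | F x}, ⟨⟨?_, ?_, ?_, ?_⟩, ?_⟩, ?_⟩
  · show F ⊤
    rw [hF.top]; trivial
  · show ¬ F ⊥
    rw [hF.bot]; exact id
  · intro a c ha hac
    exact hF.mono hac ha
  · intro a c ha hc
    show F (a ⊓ c)
    rw [hF.inf]; exact ⟨ha, hc⟩
  · intro a
    show F a ∨ F aᶜ
    rw [hF.compl]; exact em _
  · exact h b ⊤ (by simp) trivial

section Ult
variable {B : Type} [CompleteBooleanAlgebra B] {U : Set B}

theorem ult_inf (hU : IsBUltrafilter U) {a b : B} : a ⊓ b ∈ U ↔ a ∈ U ∧ b ∈ U :=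
  ⟨fun h => ⟨hU.1.2.2.1 _ _ h inf_le_left, hU.1.2.2.1 _ _ h inf_le_right⟩,
    fun h => hU.1.2.2.2 _ _ h.1 h.2⟩

theorem ult_compl (hU : IsBUltrafilter U) {a : B} : aᶜ ∈ U ↔ a ∉ U := by
  constructor
  · intro h h'
    have := hU.1.2.2.2 _ _ h h'
    rw [compl_inf_eq_bot] at this
    exact hU.1.2.1 this
  · intro h
    exact (hU.2 a).resolve_left h

theorem ult_finset (hU : IsBUltrafilter U) {ι : Type*} (s : Finset ι) (a : ι → B) :
    s.inf a ∈ U ↔ ∀ i ∈ s, a i ∈ U := by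
  classical
  induction s using Finset.induction_on with
  | empty => simp [hU.1.1]
  | insert i s hi ih => rw [Finset.inf_insert, ult_inf hU, ih]; simp

/-- An indexed family of ultrafilters is a homomorphism to a power set. -/
theorem isHom_ult {I : Type} (V : I → Set B) (hV : ∀ i, IsBUltrafilter (V i)) :
    IsHom fun b : B => {i : I | b ∈ V i} := by
  refine ⟨?_, ?_, ?_⟩
  · intro x y; ext i; simp [ult_inf (hV i)]
  · intro x; ext i; simp [ult_compl (hV i)]
  · ext i; simp [(hV i).1.1]

theorem ult_pull {B' : Type} [CompleteBooleanAlgebra B'] {F : B' → B} (hF : IsHom F)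
    (hU : IsBUltrafilter U) : IsBUltrafilter {b | F b ∈ U} := by
  refine ⟨⟨?_, ?_, ?_, ?_⟩, ?_⟩
  · show F ⊤ ∈ U; rw [hF.top]; exact hU.1.1
  · show F ⊥ ∉ U; rw [hF.bot]; exact hU.1.2.1
  · intro a b ha hab; exact hU.1.2.2.1 _ _ ha (hF.mono hab)
  · intro a b ha hb; show F (a ⊓ b) ∈ U; rw [hF.inf]; exact hU.1.2.2.2 _ _ ha hb
  · intro a; show F a ∈ U ∨ F aᶜ ∈ U; rw [hF.compl]; exact hU.2 _
end Ult

/-- Finite patterns: pairs of finite sets of finite sets. -/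
abbrev Pat (I : Type) : Type := Finset (Finset I) × Finset (Finset I)

/-- The Boolean value of a pattern. -/
def pval {I B : Type} [BooleanAlgebra B] (A : Finset I → B) (p : Pat I) : B :=
  p.1.inf A ⊓ p.2.inf fun s => (A s)ᶜ

theorem pval_hom {I B B' : Type} [BooleanAlgebra B] [BooleanAlgebra B'] {F : B → B'} (hF : IsHom F)
    (A : Finset I → B) (p : Pat I) : pval (fun s => F (A s)) p = F (pval A p) := by
  simp only [pval, hF.inf, hF.finset_inf, hF.compl]

/-- `A` only realizes patterns in `Q`. -/
def Compat {I B : Type} [BooleanAlgebra B] (Q : Set (Pat I)) (A : Finset I → B) : Prop :=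
  ∀ p, p ∉ Q → pval A p = ⊥

theorem Compat.hom {I B B' : Type} [BooleanAlgebra B] [BooleanAlgebra B'] {F : B → B'} (hF : IsHom F)
    {Q : Set (Pat I)} {A : Finset I → B} (h : Compat Q A) : Compat Q fun s => F (A s) := by
  intro p hp
  rw [pval_hom hF, h p hp, hF.bot]

/-- Existence of a multiplicative refinement in `U`. -/
def HasMR {I B : Type} [BooleanAlgebra B] (U : Set B) (A : Finset I → B) : Prop :=
  ∃ a : I → B, (∀ i, a i ∈ U) ∧ ∀ s : Finset I, s.inf a ≤ A s

end UPB

namespace UPB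

theorem indep (I : Type) [Infinite I] : ∃ g : Set I → I → I, ∀ (D : Finset (Set I)) (k : Set I → I),
    ∃ α, ∀ γ ∈ D, g γ α = k γ := by
  classical
  have hc : #I = #(Finset I × Finset (Finset I × I)) := by
    have h : ℵ₀ ≤ #I := Cardinal.aleph0_le_mk I
    rw [Cardinal.mk_prod, Cardinal.mk_finset_of_infinite, Cardinal.mk_finset_of_infinite,
      Cardinal.mk_prod, Cardinal.mk_finset_of_infinite]
    simp [Cardinal.mul_eq_self h]
  obtain ⟨e⟩ := Cardinal.eq.mp hc
  let i0 : I := Classical.arbitrary I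
  let g : Set I → I → I := fun γ α =>
    if h : ∃ k, ((e α).1.filter (· ∈ γ), k) ∈ (e α).2 then h.choose else i0
  refine ⟨g, fun D k => ?_⟩
  -- a finite set separating the elements of D
  have hsep : ∀ γ γ' : Set I, ∃ x : I, γ ≠ γ' → ¬ (x ∈ γ ↔ x ∈ γ') := by
    intro γ γ'
    by_cases h : γ = γ'
    · exact ⟨i0, fun h' => absurd h h'⟩
    · have : ∃ x, ¬ (x ∈ γ ↔ x ∈ γ') := by
        by_contra hcon
        push Not at hcon
        exact h (Set.ext hcon)
      obtain ⟨x, hx⟩ := this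
      exact ⟨x, fun _ => hx⟩
  choose sp hsp using hsep
  let F : Finset I := (D ×ˢ D).image fun p => sp p.1 p.2
  have hF : ∀ γ ∈ D, ∀ γ' ∈ D, F.filter (· ∈ γ) = F.filter (· ∈ γ') → γ = γ' := by
    intro γ h γ' h' heq
    by_contra hne
    apply hsp γ γ' hne
    have hm : sp γ γ' ∈ F := Finset.mem_image.mpr ⟨(γ, γ'), by simp [h, h'], rfl⟩
    have := Finset.ext_iff.mp heq (sp γ γ')
    simpa [hm] using this
  let m : Finset (Finset I × I) := D.image fun γ => (F.filter (· ∈ γ), k γ)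
  refine ⟨e.symm (F, m), fun γ hγ => ?_⟩
  have hex : ∃ k', ((e (e.symm (F, m))).1.filter (· ∈ γ), k') ∈ (e (e.symm (F, m))).2 := by
    refine ⟨k γ, ?_⟩
    simp only [Equiv.apply_symm_apply]
    exact Finset.mem_image.mpr ⟨γ, hγ, rfl⟩
  have hg : g γ (e.symm (F, m)) = hex.choose := dif_pos hex
  have h2 := hex.choose_spec
  rw [← hg] at h2
  simp only [Equiv.apply_symm_apply] at h2
  obtain ⟨γ', h', heq⟩ := Finset.mem_image.mp h2
  obtain ⟨h3, h4⟩ := Prod.mk.inj heq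
  rw [← h4, hF γ' h' γ hγ h3]

section CC
variable {B : Type} [CompleteBooleanAlgebra B]

theorem antichain_lt_cc (S : Set B) (hS : IsBAntichain S) : #S < ccOf B := by
  have hne : {κ : Cardinal | ∀ S : Set B, IsBAntichain S → Cardinal.mk S < κ}.Nonempty :=
    ⟨Order.succ #B, fun S _ => Order.lt_succ_of_le (Cardinal.mk_set_le S)⟩
  exact csInf_mem hne S hS

theorem cc_pos : 0 < ccOf B := by
  have := antichain_lt_cc (∅ : Set B) ⟨by simp, by simp⟩
  simpa using this

/-- Suprema are attained on small subfamilies. -/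
theorem small_sup {J : Type} (c : J → B) : ∃ W : Set J, #W < ccOf B ∧ ⨆ j, c j ≤ ⨆ w : W, c w := by
  classical
  rcases isEmpty_or_nonempty J with hJ | hJ
  · exact ⟨∅, by simpa using cc_pos, by simp⟩
  obtain ⟨M, hM⟩ := zorn_subset {S : Set B | IsBAntichain S ∧ ∀ a ∈ S, ∃ j, a ≤ c j} (by
    intro ch hch hc
    refine ⟨⋃₀ ch, ⟨⟨?_, ?_⟩, ?_⟩, fun s hs => Set.subset_sUnion_of_mem hs⟩
    · rintro a ⟨s, hs, ha⟩
      exact (hch hs).1.1 a ha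
    · rintro a ⟨s, hs, ha⟩ b ⟨t, ht, hb⟩ hab
      rcases hc.total hs ht with h | h
      · exact (hch ht).1.2 (h ha) hb hab
      · exact (hch hs).1.2 ha (h hb) hab
    · rintro a ⟨s, hs, ha⟩
      exact (hch hs).2 a ha)
  have hP := hM.prop
  choose! f hf using hP.2
  refine ⟨f '' M, lt_of_le_of_lt Cardinal.mk_image_le (antichain_lt_cc M hP.1), ?_⟩
  have hle : ∀ a ∈ M, a ≤ ⨆ w : (f '' M), c w := fun a ha =>
    (hf a ha).trans (le_iSup (fun w : (f '' M) => c w) ⟨f a, Set.mem_image_of_mem _ ha⟩)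
  apply iSup_le
  intro j
  by_contra hj
  set d := c j ⊓ (⨆ w : (f '' M), c w)ᶜ with hd
  have hd0 : d ≠ ⊥ := by
    intro h0
    apply hj
    rw [hd, ← disjoint_iff, disjoint_compl_right_iff] at h0
    exact h0
  have hdisj : ∀ a ∈ M, a ⊓ d = ⊥ := by
    intro a ha
    rw [← disjoint_iff]
    exact (disjoint_compl_right.mono_left (hle a ha)).mono_right inf_le_right
  have hmem : d ∈ M := by
    apply hM.le_of_ge (y := insert d M) _ (Set.subset_insert _ _) (Set.mem_insert _ _)
    refine ⟨⟨?_, ?_⟩, ?_⟩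
    · rintro a (rfl | ha)
      · exact hd0
      · exact hP.1.1 a ha
    · refine Set.Pairwise.insert hP.1.2 ?_
      intro b hb _
      exact ⟨by rw [inf_comm]; exact hdisj b hb, hdisj b hb⟩
    · rintro a (rfl | ha)
      · exact ⟨j, inf_le_left⟩
      · exact hP.2 a ha
  have := hdisj d hmem
  rw [inf_idem] at this
  exact hd0 this

end CC

/-- Smallness of sets of used functions. -/
def Small (B : Type) [CompleteBooleanAlgebra B] {Γ : Type} (Δ : Set Γ) : Prop :=
  ∃ κ : Cardinal, κ < ccOf B ∧ #Δ ≤ max κ ℵ₀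

theorem small_union {B : Type} [CompleteBooleanAlgebra B] {Γ Z : Type} (lam : Cardinal)
    (hlam : ℵ₀ ≤ lam) (hcc : ∀ κ : Cardinal, κ < ccOf B → (2 : Cardinal) ^ κ ≤ (2 : Cardinal) ^ lam)
    (hZ : #Z < 2 ^ lam) (Δ : Z → Set Γ) (hΔ : ∀ z, Small B (Δ z)) : #(⋃ z, Δ z) < 2 ^ lam := by
  have hμ : ℵ₀ < 2 ^ lam := lt_of_le_of_lt hlam (Cardinal.cantor lam)
  choose κ hκ hk using hΔ
  have h1 : #(⋃ z, Δ z) ≤ Cardinal.sum (fun z => κ z) + #Z * ℵ₀ := by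
    refine Cardinal.mk_iUnion_le_sum_mk.trans ?_
    refine (Cardinal.sum_le_sum _ (fun z => κ z + ℵ₀) fun z => (hk z).trans ?_).trans ?_
    · exact max_le (self_le_add_right _ _) (self_le_add_left _ _)
    · rw [Cardinal.sum_add_distrib']
      simp
  refine lt_of_le_of_lt h1 (Cardinal.add_lt_of_lt hμ.le ?_ (Cardinal.mul_lt_of_lt hμ.le hZ hμ))
  by_cases hc : #Z < ccOf B
  · have h2 : Cardinal.sum (fun z => κ z) < Cardinal.prod fun _ : Z => (2 : Cardinal) ^ lam :=
      Cardinal.sum_lt_prod _ _ fun z => lt_of_lt_of_le (Cardinal.cantor _) (hcc _ (hκ z))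
    refine lt_of_lt_of_le h2 ?_
    rw [Cardinal.prod_const, Cardinal.lift_id, Cardinal.lift_id, ← Cardinal.power_mul]
    refine (Cardinal.power_le_power_left two_ne_zero
      (Cardinal.mul_le_max_of_aleph0_le_left hlam)).trans ?_
    rcases le_total lam #Z with h | h
    · rw [max_eq_right h]; exact hcc _ hc
    · rw [max_eq_left h]
  · push Not at hc
    refine lt_of_le_of_lt (Cardinal.sum_le_sum _ (fun _ => #Z) fun z => (hκ z).le.trans hc) ?_
    simp only [Cardinal.sum_const, Cardinal.lift_id]
    exact Cardinal.mul_lt_of_lt hμ.le hZ hZ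

section Constr
variable {I Γ B : Type} [CompleteBooleanAlgebra B] (g : Γ → I → I)

/-- The state of the construction: a meet-closed set of constraints `R`, independent of the
functions with index outside `S`. -/
structure St (R : Set (Set I × B)) (S : Set Γ) : Prop where
  top : (⊤, ⊤) ∈ R
  inf : ∀ x y x' y', (x, y) ∈ R → (x', y') ∈ R → (x ⊓ x', y ⊓ y') ∈ R
  cons : ∀ x y, (x, y) ∈ R → ∀ D : Finset Γ, (∀ γ ∈ D, γ ∉ S) → ∀ k : Γ → I,
    (∀ α ∈ x, ∃ γ ∈ D, g γ α ≠ k γ) → y = ⊥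

variable {g}

theorem transfinite [Nonempty I] {Ω : Type} [LinearOrder Ω] [WellFoundedLT Ω] (lam : Cardinal)
    (hlam : ℵ₀ ≤ lam) (hcc : ∀ κ : Cardinal, κ < ccOf B → (2 : Cardinal) ^ κ ≤ (2 : Cardinal) ^ lam)
    (hseg : ∀ ξ : Ω, #(Set.Iio ξ) < 2 ^ lam) (h0 : St (B := B) g {(⊤, ⊤)} ∅)
    (task : Ω → Set (Set I × B) → Set (Set I × B) → Prop)
    (step : ∀ ξ R S, St g R S → #S < 2 ^ lam → ∃ R' S', R ⊆ R' ∧ S ⊆ S' ∧ St g R' S' ∧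
      Small B (S' \ S) ∧ task ξ R R') :
    ∃ (pre post : Ω → Set (Set I × B)) (R : Set (Set I × B)), Good R ∧ (∀ ξ, pre ξ ⊆ R) ∧
      (∀ ξ, post ξ ⊆ R) ∧ (∀ ξ η, η < ξ → post η ⊆ pre ξ) ∧ ∀ ξ, task ξ (pre ξ) (post ξ) := by
  classical
  have hst : ∀ (ξ : Ω) (s : Set (Set I × B) × Set Γ), ∃ s' : Set (Set I × B) × Set Γ,
      s.1 ⊆ s'.1 ∧ s.2 ⊆ s'.2 ∧ Small B (s'.2 \ s.2) ∧
      (St g s.1 s.2 → #s.2 < 2 ^ lam → St g s'.1 s'.2 ∧ task ξ s.1 s'.1) := by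
    intro ξ s
    by_cases h : St g s.1 s.2 ∧ #s.2 < 2 ^ lam
    · obtain ⟨R', S', h1, h2, h3, h4, h5⟩ := step ξ s.1 s.2 h.1 h.2
      exact ⟨(R', S'), h1, h2, h4, fun _ _ => ⟨h3, h5⟩⟩
    · refine ⟨s, le_rfl, le_rfl, ⟨0, cc_pos, by simp⟩, fun h1 h2 => absurd ⟨h1, h2⟩ h⟩
  choose nxt hn1 hn2 hn3 hn4 using hst
  let rec' : ∀ ξ : Ω, (∀ η, η < ξ → Set (Set I × B) × Set Γ) → Set (Set I × B) × Set Γ :=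
    fun ξ ih => nxt ξ ({(⊤, ⊤)} ∪ ⋃ η : Set.Iio ξ, (ih η.1 η.2).1, ⋃ η : Set.Iio ξ, (ih η.1 η.2).2)
  obtain ⟨P, hP⟩ : ∃ P : Ω → Set (Set I × B) × Set Γ, ∀ ξ, P ξ =
      nxt ξ ({(⊤, ⊤)} ∪ ⋃ η : Set.Iio ξ, (P η.1).1, ⋃ η : Set.Iio ξ, (P η.1).2) :=
    ⟨wellFounded_lt.fix rec', fun ξ => wellFounded_lt.fix_eq rec' ξ⟩
  set pr : Ω → Set (Set I × B) × Set Γ := fun ξ =>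
    ({(⊤, ⊤)} ∪ ⋃ η : Set.Iio ξ, (P η.1).1, ⋃ η : Set.Iio ξ, (P η.1).2) with hpr
  have hPpr : ∀ ξ, P ξ = nxt ξ (pr ξ) := hP
  have hlt1 : ∀ ξ η, η < ξ → (P η).1 ⊆ (pr ξ).1 := fun ξ η h x hx =>
    Or.inr (Set.mem_iUnion.mpr ⟨⟨η, h⟩, hx⟩)
  have hlt2 : ∀ ξ η, η < ξ → (P η).2 ⊆ (pr ξ).2 := fun ξ η h x hx =>
    Set.mem_iUnion.mpr ⟨⟨η, h⟩, hx⟩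
  have hpp1 : ∀ ξ, (pr ξ).1 ⊆ (P ξ).1 := fun ξ => by rw [hPpr]; exact hn1 _ _
  have hpp2 : ∀ ξ, (pr ξ).2 ⊆ (P ξ).2 := fun ξ => by rw [hPpr]; exact hn2 _ _
  have hmono : ∀ ξ η, η ≤ ξ → (P η).1 ⊆ (P ξ).1 ∧ (P η).2 ⊆ (P ξ).2 := by
    intro ξ η h
    rcases h.eq_or_lt with rfl | h
    · exact ⟨le_rfl, le_rfl⟩
    · exact ⟨(hlt1 _ _ h).trans (hpp1 _), (hlt2 _ _ h).trans (hpp2 _)⟩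
  have hΔ : ∀ ξ, ∀ x ∈ (P ξ).2, ∃ η ≤ ξ, x ∈ (P η).2 \ (pr η).2 := by
    intro ξ
    induction ξ using WellFoundedLT.induction with
    | ind ξ ih =>
      intro x hx
      by_cases h : x ∈ (pr ξ).2
      · obtain ⟨⟨η, hη⟩, hx'⟩ := Set.mem_iUnion.mp h
        obtain ⟨ζ, hζ, hx''⟩ := ih η hη x hx'
        exact ⟨ζ, hζ.trans (le_of_lt hη), hx''⟩
      · exact ⟨ξ, le_rfl, hx, h⟩
  have hcard : ∀ ξ, #(pr ξ).2 < 2 ^ lam := by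
    intro ξ
    refine lt_of_le_of_lt (Cardinal.mk_le_mk_of_subset ?_)
      (small_union (B := B) lam hlam hcc (hseg ξ) (fun η : Set.Iio ξ => (P η.1).2 \ (pr η.1).2) ?_)
    · intro x hx
      obtain ⟨⟨η, hη⟩, hx'⟩ := Set.mem_iUnion.mp hx
      obtain ⟨ζ, hζ, hx''⟩ := hΔ η x hx'
      exact Set.mem_iUnion.mpr ⟨⟨ζ, lt_of_le_of_lt hζ hη⟩, hx''⟩
    · intro z
      rw [hPpr]
      exact hn3 _ _
  have huni : ∀ (J : Set Ω), (∀ η ∈ J, St g (P η).1 (P η).2) →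
      St g ({(⊤, ⊤)} ∪ ⋃ η : J, (P η.1).1) (⋃ η : J, (P η.1).2) := by
    intro J hJ
    refine ⟨Or.inl rfl, ?_, ?_⟩
    · rintro x y x' y' (h1 | h1) (h2 | h2)
      · left
        rw [Set.mem_singleton_iff, Prod.mk.injEq] at h1 h2 ⊢
        simp [h1, h2]
      · rw [Set.mem_singleton_iff, Prod.mk.injEq] at h1
        rw [h1.1, h1.2, top_inf_eq, top_inf_eq]
        exact Or.inr h2
      · rw [Set.mem_singleton_iff, Prod.mk.injEq] at h2
        rw [h2.1, h2.2, inf_top_eq, inf_top_eq]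
        exact Or.inr h1
      · right
        obtain ⟨⟨η, hη⟩, h1⟩ := Set.mem_iUnion.mp h1
        obtain ⟨⟨ζ, hζ⟩, h2⟩ := Set.mem_iUnion.mp h2
        rcases le_total η ζ with h | h
        · exact Set.mem_iUnion.mpr ⟨⟨ζ, hζ⟩, (hJ ζ hζ).inf _ _ _ _ ((hmono _ _ h).1 h1) h2⟩
        · exact Set.mem_iUnion.mpr ⟨⟨η, hη⟩, (hJ η hη).inf _ _ _ _ h1 ((hmono _ _ h).1 h2)⟩
    · rintro x y (h1 | h1) D hD k hk
      · exact h0.cons x y h1 D (by simp) k hk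
      · obtain ⟨⟨η, hη⟩, h1⟩ := Set.mem_iUnion.mp h1
        exact (hJ η hη).cons x y h1 D
          (fun γ hγ hγ' => hD γ hγ (Set.mem_iUnion.mpr ⟨⟨η, hη⟩, hγ'⟩)) k hk
  have hSt : ∀ ξ, St g (P ξ).1 (P ξ).2 := by
    intro ξ
    induction ξ using WellFoundedLT.induction with
    | ind ξ ih =>
      have := huni (Set.Iio ξ) (fun η hη => ih η hη)
      rw [hPpr]
      exact (hn4 ξ (pr ξ) this (hcard ξ)).1
  have hfin := huni Set.univ (fun η _ => hSt η)
  refine ⟨fun ξ => (pr ξ).1, fun ξ => (P ξ).1, _, ⟨hfin.top, hfin.inf, ?_⟩, ?_, ?_, hlt1, ?_⟩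
  · intro b hb
    exact hfin.cons _ _ hb ∅ (by simp) (fun _ => Classical.arbitrary I)
      (fun α hα => absurd hα (Set.notMem_empty α))
  · intro ξ x hx
    exact Or.inr (Set.mem_iUnion.mpr ⟨⟨ξ, trivial⟩, hpp1 ξ hx⟩)
  · intro ξ x hx
    exact Or.inr (Set.mem_iUnion.mpr ⟨⟨ξ, trivial⟩, hx⟩)
  · intro ξ
    have := (hn4 ξ (pr ξ) (huni (Set.Iio ξ) fun η _ => hSt η) (hcard ξ)).2
    rw [← hPpr] at this
    exact this

end Constr
end UPB

namespace UPB
section Steps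
variable {I Γ B : Type} [CompleteBooleanAlgebra B] {g : Γ → I → I}

theorem St.mul {R : Set (Set I × B)} {S S' : Set Γ} (h : St g R S) (hS : S ⊆ S')
    (P : Set (Set I × B)) (hP1 : (⊤, ⊤) ∈ P)
    (hP2 : ∀ x y x' y', (x, y) ∈ P → (x', y') ∈ P → (x ⊓ x', y ⊓ y') ∈ P)
    (hP3 : ∀ x y z w, (x, y) ∈ R → (z, w) ∈ P → ∀ D : Finset Γ, (∀ γ ∈ D, γ ∉ S') → ∀ k : Γ → I,
      (∀ α ∈ x, α ∈ z → ∃ γ ∈ D, g γ α ≠ k γ) → y ⊓ w = ⊥) :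
    ∃ R', R ⊆ R' ∧ P ⊆ R' ∧ S ⊆ S' ∧ St g R' S' := by
  refine ⟨{q | ∃ x y z w, (x, y) ∈ R ∧ (z, w) ∈ P ∧ q = (x ⊓ z, y ⊓ w)}, ?_, ?_, hS, ?_, ?_, ?_⟩
  · rintro ⟨x, y⟩ hxy
    exact ⟨x, y, ⊤, ⊤, hxy, hP1, by simp⟩
  · rintro ⟨x, y⟩ hxy
    exact ⟨⊤, ⊤, x, y, h.top, hxy, by simp⟩
  · exact ⟨⊤, ⊤, ⊤, ⊤, h.top, hP1, by simp⟩
  · rintro x y x' y' ⟨a, b, c, d, h1, h2, h3⟩ ⟨a', b', c', d', h1', h2', h3'⟩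
    obtain ⟨rfl, rfl⟩ := Prod.mk.inj h3
    obtain ⟨rfl, rfl⟩ := Prod.mk.inj h3'
    refine ⟨_, _, _, _, h.inf _ _ _ _ h1 h1', hP2 _ _ _ _ h2 h2', ?_⟩
    rw [inf_inf_inf_comm, inf_inf_inf_comm b]
  · rintro x y ⟨a, b, c, d, h1, h2, h3⟩ D hD k hk
    obtain ⟨rfl, rfl⟩ := Prod.mk.inj h3
    exact hP3 _ _ _ _ h1 h2 D hD k fun α h1 h2 => hk α ⟨h1, h2⟩

theorem small_finset_union {W : Type} (hW : #W < ccOf B) (D : W → Finset Γ) :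
    Small B (⋃ w, (D w : Set Γ)) := by
  refine ⟨#W, hW, ?_⟩
  refine Cardinal.mk_iUnion_le_sum_mk.trans ?_
  refine (Cardinal.sum_le_sum _ (fun _ => ℵ₀) fun w => ?_).trans ?_
  · exact (Cardinal.lt_aleph0_of_finite _).le
  · simp only [Cardinal.sum_const, Cardinal.lift_id]
    exact Cardinal.mul_le_max_of_aleph0_le_right le_rfl

theorem Small.mono {S S' : Set Γ} (h : Small B S') (hs : S ⊆ S') : Small B S := by
  obtain ⟨κ, h1, h2⟩ := h
  exact ⟨κ, h1, (Cardinal.mk_le_mk_of_subset hs).trans h2⟩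

theorem small_singleton (γ : Γ) : Small B ({γ} : Set Γ) :=
  ⟨0, cc_pos, by simp⟩

theorem step_decide {R : Set (Set I × B)} {S : Set Γ} (h : St g R S) (X : Set I) :
    ∃ R' S', R ⊆ R' ∧ S ⊆ S' ∧ St g R' S' ∧ Small B (S' \ S) ∧ ∃ b, (X, b) ∈ R' ∧ (Xᶜ, bᶜ) ∈ R' := by
  classical
  let J : Type := {q : (Set I × B) × Finset Γ × (Γ → I) // q.1 ∈ R ∧ (∀ γ ∈ q.2.1, γ ∉ S) ∧
    ∀ α ∈ q.1.1, α ∈ X → ∃ γ ∈ q.2.1, g γ α ≠ q.2.2 γ}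
  obtain ⟨W, hW, hle⟩ := small_sup (fun j : J => j.1.1.2)
  set c := ⨆ j : J, j.1.1.2 with hc
  set S' : Set Γ := S ∪ ⋃ w : W, (w.1.1.2.1 : Set Γ) with hS'
  obtain ⟨R', h1, h2, h3, h4⟩ := h.mul (S' := S') Set.subset_union_left
    {(⊤, ⊤), (X, cᶜ), (Xᶜ, c), (⊥, ⊥)} (by simp) (by
      intro x y x' y' ha hb
      simp only [Set.mem_insert_iff, Set.mem_singleton_iff, Prod.mk.injEq] at ha hb ⊢
      rcases ha with ⟨rfl, rfl⟩ | ⟨rfl, rfl⟩ | ⟨rfl, rfl⟩ | ⟨rfl, rfl⟩ <;>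
      rcases hb with ⟨rfl, rfl⟩ | ⟨rfl, rfl⟩ | ⟨rfl, rfl⟩ | ⟨rfl, rfl⟩ <;> simp) (by
      have hD' : ∀ D : Finset Γ, (∀ γ ∈ D, γ ∉ S') → ∀ γ ∈ D, γ ∉ S :=
        fun D hD γ hγ hs => hD γ hγ (Or.inl hs)
      intro x y z w hxy hzw D hD k hk
      simp only [Set.mem_insert_iff, Set.mem_singleton_iff, Prod.mk.injEq] at hzw
      rcases hzw with ⟨rfl, rfl⟩ | ⟨rfl, rfl⟩ | ⟨rfl, rfl⟩ | ⟨rfl, rfl⟩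
      · rw [inf_top_eq]
        exact h.cons x y hxy D (hD' D hD) k fun α hα => hk α hα trivial
      · rw [← disjoint_iff, disjoint_compl_right_iff]
        exact le_iSup (fun j : J => j.1.1.2) ⟨((x, y), D, k), hxy, hD' D hD, hk⟩
      · rw [eq_bot_iff]
        refine (inf_le_inf_left y hle).trans ?_
        rw [inf_iSup_eq]
        refine iSup_le fun w => le_of_eq ?_
        obtain ⟨⟨⟨⟨xw, yw⟩, Dw, kw⟩, hw1, hw2, hw3⟩, hwW⟩ := w
        refine h.cons (x ⊓ xw) (y ⊓ yw) (h.inf _ _ _ _ hxy hw1) (D ∪ Dw) ?_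
          (fun γ => if γ ∈ D then k γ else kw γ) ?_
        · intro γ hγ
          rcases Finset.mem_union.mp hγ with hγ | hγ
          · exact hD' D hD γ hγ
          · exact hw2 γ hγ
        · rintro α ⟨hα, hα'⟩
          by_cases hX : α ∈ X
          · obtain ⟨γ, hγ, hne⟩ := hw3 α hα' hX
            have hnD : γ ∉ D := fun hd => hD γ hd (Or.inr (Set.mem_iUnion.mpr ⟨⟨_, hwW⟩, hγ⟩))
            exact ⟨γ, Finset.mem_union_right _ hγ, by simpa [hnD] using hne⟩
          · obtain ⟨γ, hγ, hne⟩ := hk α hα hX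
            exact ⟨γ, Finset.mem_union_left _ hγ, by simpa [hγ] using hne⟩
      · exact inf_bot_eq y)
  refine ⟨R', S', h1, h3, h4, (small_finset_union hW fun w : W => w.1.1.2.1).mono ?_, cᶜ, h2 (by simp), h2 (by simp)⟩
  rintro x ⟨hx | hx, hx'⟩
  · exact absurd hx hx'
  · exact hx

theorem exists_fresh {lam : Cardinal} {S : Set Γ} (hΓ : #Γ = 2 ^ lam) (hS : #S < 2 ^ lam) :
    ∃ γ, γ ∉ S := by
  by_contra hcon
  push Not at hcon
  have : S = Set.univ := Set.eq_univ_of_forall hcon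
  rw [this, Cardinal.mk_univ, hΓ] at hS
  exact lt_irrefl _ hS

theorem step_solve {R : Set (Set I × B)} {S : Set Γ} (h : St g R S) (hfr : ∃ γ, γ ∉ S)
    (e : I → Finset I) (he : Function.Surjective e) (U : Set B)
    (A0 : Finset I → Set I) (hanti : ∀ s t, s ⊆ t → A0 t ⊆ A0 s) (htop : A0 ∅ = Set.univ)
    (A1 : I → B) (hA1 : ∀ i, A1 i ∈ U) (hle : ∀ s : Finset I, ∃ b, s.inf A1 ≤ b ∧ (A0 s, b) ∈ R) :
    ∃ R' S', R ⊆ R' ∧ S ⊆ S' ∧ St g R' S' ∧ Small B (S' \ S) ∧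
      ∃ Bf : I → Set I, (∀ α, {i | α ∈ Bf i}.Finite) ∧
        (∀ s : Finset I, (⋂ i ∈ s, Bf i) ⊆ A0 s) ∧ ∀ i, ∃ b ∈ U, (Bf i, b) ∈ R' := by
  classical
  obtain ⟨γ, hγ⟩ := hfr
  set Bf : I → Set I := fun i => {α | i ∈ e (g γ α) ∧ α ∈ A0 (e (g γ α))} with hBf
  obtain ⟨R', h1, h2, h3, h4⟩ := h.mul (S' := S ∪ {γ}) Set.subset_union_left
    {q | ∃ s : Finset I, q = (s.inf Bf, s.inf A1)} ⟨∅, by simp⟩ (by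
      rintro x y x' y' ⟨s, hs⟩ ⟨t, ht⟩
      obtain ⟨rfl, rfl⟩ := Prod.mk.inj hs
      obtain ⟨rfl, rfl⟩ := Prod.mk.inj ht
      exact ⟨s ∪ t, by rw [Finset.inf_union, Finset.inf_union]⟩) (by
      rintro x y z w hxy ⟨s, hs⟩ D hD k hk
      obtain ⟨rfl, rfl⟩ := Prod.mk.inj hs
      obtain ⟨b, hb, hbR⟩ := hle s
      obtain ⟨i, hi⟩ := he s
      have hγD : γ ∉ D := fun hd => hD γ hd (Or.inr rfl)
      have := h.cons _ _ (h.inf _ _ _ _ hxy hbR) (insert γ D) (by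
        intro γ' h'
        rcases Finset.mem_insert.mp h' with rfl | h'
        · exact hγ
        · exact fun hs => hD γ' h' (Or.inl hs)) (fun γ' => if γ' = γ then i else k γ') (by
        rintro α ⟨hα, hα'⟩
        by_cases hgi : g γ α = i
        · obtain ⟨γ', h', hne⟩ := hk α hα (by
            rw [Finset.inf_set_eq_iInter]
            simp only [Set.mem_iInter, hBf, Set.mem_ofPred_eq, hgi, hi]
            exact fun j hj => ⟨hj, hα'⟩)
          refine ⟨γ', Finset.mem_insert_of_mem h', ?_⟩
          have : γ' ≠ γ := fun hh => hγD (hh ▸ h')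
          simpa [this] using hne
        · exact ⟨γ, Finset.mem_insert_self _ _, by simpa using hgi⟩)
      exact eq_bot_iff.mpr ((inf_le_inf_left y hb).trans this.le))
  refine ⟨R', _, h1, h3, h4, (small_singleton γ).mono ?_, Bf, ?_, ?_, ?_⟩
  · rintro x ⟨hx | hx, hx'⟩
    · exact absurd hx hx'
    · exact hx
  · intro α
    exact (e (g γ α)).finite_toSet.subset fun i hi => hi.1
  · intro s α hα
    simp only [Set.mem_iInter] at hα
    rcases s.eq_empty_or_nonempty with rfl | ⟨i, hi⟩
    · rw [htop]; trivial
    · exact hanti s _ (fun j hj => (hα j hj).1) (hα i hi).2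
  · intro i
    exact ⟨A1 i, hA1 i, h2 ⟨{i}, by simp⟩⟩

theorem step_lift {R : Set (Set I × B)} {S : Set Γ} (h : St g R S) (hfr : ∃ γ, γ ∉ S)
    (e : I → Pat I) (he : Function.Surjective e) (hB : (⊤ : B) ≠ ⊥) (C : Finset I → B) :
    ∃ R' S', R ⊆ R' ∧ S ⊆ S' ∧ St g R' S' ∧ Small B (S' \ S) ∧
      ∃ f : B → Set I, IsHom f ∧ ∀ s, (f (C s), C s) ∈ R' ∧ ((f (C s))ᶜ, (C s)ᶜ) ∈ R' := by
  classical
  obtain ⟨γ, hγ⟩ := hfr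
  have hV : ∀ p : Pat I, ∃ V : Set B, IsBUltrafilter V ∧ (pval C p ≠ ⊥ → pval C p ∈ V) := by
    intro p
    by_cases hp : pval C p = ⊥
    · obtain ⟨V, hV, _⟩ := exists_ult (⊤ : B) hB
      exact ⟨V, hV, fun h => absurd hp h⟩
    · obtain ⟨V, hV, h⟩ := exists_ult _ hp
      exact ⟨V, hV, fun _ => h⟩
  choose V hV hVp using hV
  have hf : IsHom (fun b : B => {α : I | b ∈ V (e (g γ α))}) :=
    isHom_ult (fun α => V (e (g γ α))) fun α => hV _
  set f : B → Set I := fun b : B => {α : I | b ∈ V (e (g γ α))} with hfd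
  obtain ⟨R', h1, h2, h3, h4⟩ := h.mul (S' := S ∪ {γ}) Set.subset_union_left
    {q | ∃ p : Pat I, q = (f (pval C p), pval C p)} ⟨(∅, ∅), by simp [pval, hf.top]⟩ (by
      rintro x y x' y' ⟨s, hs⟩ ⟨t, ht⟩
      obtain ⟨rfl, rfl⟩ := Prod.mk.inj hs
      obtain ⟨rfl, rfl⟩ := Prod.mk.inj ht
      have : pval C s ⊓ pval C t = pval C (s.1 ∪ t.1, s.2 ∪ t.2) := by
        simp only [pval, Finset.inf_union]
        rw [inf_inf_inf_comm]
      exact ⟨(s.1 ∪ t.1, s.2 ∪ t.2), by rw [← hf.inf, this]⟩) (by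
      rintro x y z w hxy ⟨p, hp⟩ D hD k hk
      obtain ⟨rfl, rfl⟩ := Prod.mk.inj hp
      by_cases hp0 : pval C p = ⊥
      · rw [hp0, inf_bot_eq]
      obtain ⟨i, hi⟩ := he p
      have hγD : γ ∉ D := fun hd => hD γ hd (Or.inr rfl)
      have := h.cons _ _ hxy (insert γ D) (by
        intro γ' h'
        rcases Finset.mem_insert.mp h' with rfl | h'
        · exact hγ
        · exact fun hs => hD γ' h' (Or.inl hs)) (fun γ' => if γ' = γ then i else k γ') (by
        rintro α hα
        by_cases hgi : g γ α = i
        · obtain ⟨γ', h', hne⟩ := hk α hα (by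
            simp only [hfd, Set.mem_ofPred_eq, hgi, hi]
            exact hVp p hp0)
          refine ⟨γ', Finset.mem_insert_of_mem h', ?_⟩
          have : γ' ≠ γ := fun hh => hγD (hh ▸ h')
          simpa [this] using hne
        · exact ⟨γ, Finset.mem_insert_self _ _, by simpa using hgi⟩)
      rw [this, bot_inf_eq])
  refine ⟨R', _, h1, h3, h4, (small_singleton γ).mono ?_, f, hf, ?_⟩
  · rintro x ⟨hx | hx, hx'⟩
    · exact absurd hx hx'
    · exact hx
  · intro s
    exact ⟨h2 ⟨({s}, ∅), by simp [pval]⟩, h2 ⟨(∅, {s}), by simp [pval, hf.compl]⟩⟩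

end Steps

/-- The combinatorial core. -/
theorem thmX {I B : Type} [CompleteBooleanAlgebra B] [Infinite I]
    (hcc : ∀ κ : Cardinal, κ < ccOf B → (2 : Cardinal) ^ κ ≤ (2 : Cardinal) ^ #I)
    (U : Set B) (hU : IsBUltrafilter U) (Cd : Set (Pat I) → Finset I → B) :
    ∃ j : Set I → B, IsHom j ∧
      (∀ A0 : Finset I → Set I, (∀ s t, s ⊆ t → A0 t ⊆ A0 s) → A0 ∅ = Set.univ →
        HasMR U (fun s => j (A0 s)) → ∃ Bf : I → Set I, (∀ α, {i | α ∈ Bf i}.Finite) ∧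
        (∀ s : Finset I, (⋂ i ∈ s, Bf i) ⊆ A0 s) ∧ ∀ i, j (Bf i) ∈ U) ∧
      ∀ Q, ∃ f : B → Set I, IsHom f ∧ ∀ s, j (f (Cd Q s)) = Cd Q s := by
  classical
  have hI : ℵ₀ ≤ #I := Cardinal.aleph0_le_mk I
  have hB : (⊤ : B) ≠ ⊥ := fun h => hU.1.2.1 (h ▸ hU.1.1)
  obtain ⟨g, hg⟩ := indep I
  obtain ⟨e1⟩ : Nonempty (I ≃ Finset I) := Cardinal.eq.mp (Cardinal.mk_finset_of_infinite I).symm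
  obtain ⟨e2⟩ : Nonempty (I ≃ Pat I) := Cardinal.eq.mp (by
    simp [Pat, Cardinal.mul_eq_self hI])
  let T : Type := (Finset I → Set I) ⊕ Set (Pat I)
  have hT : #T = 2 ^ #I := by
    have h2 : ℵ₀ ≤ (2 : Cardinal) ^ #I := hI.trans (Cardinal.cantor _).le
    simp only [T, Cardinal.mk_sum, Cardinal.lift_id, ← Cardinal.power_def, Cardinal.mk_set,
      Cardinal.mk_finset_of_infinite, ← Cardinal.power_mul, Cardinal.mul_eq_self hI, Pat,
      Cardinal.mk_prod, Cardinal.add_eq_self h2]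
  obtain ⟨t⟩ : Nonempty (((2 : Cardinal) ^ #I).ord.ToType ≃ T) := Cardinal.eq.mp (by
    rw [hT, Cardinal.mk_toType, Cardinal.card_ord])
  obtain ⟨u⟩ : Nonempty ((#I).ord.ToType ≃ Finset I) := Cardinal.eq.mp (by
    rw [Cardinal.mk_toType, Cardinal.card_ord, Cardinal.mk_finset_of_infinite])
  let Ω : Type := ((2 : Cardinal) ^ #I).ord.ToType ×ₗ WithTop (#I).ord.ToType
  have hseg : ∀ ξ : Ω, #(Set.Iio ξ) < 2 ^ #I := by
    intro ξ
    have hlt : #I < 2 ^ #I := Cardinal.cantor _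
    have h2 : ℵ₀ ≤ (2 : Cardinal) ^ #I := hI.trans hlt.le
    have hle : #(Set.Iio ξ) ≤ #(Set.Iic (ofLex ξ).1 × WithTop (#I).ord.ToType) := by
      refine Cardinal.mk_le_of_injective (f := fun η : Set.Iio ξ =>
        ((⟨(ofLex η.1).1, ?_⟩ : Set.Iic (ofLex ξ).1), (ofLex η.1).2)) ?_
      · have := η.2
        rw [Set.mem_Iio, Prod.Lex.lt_iff] at this
        rcases this with h | h
        · exact h.le
        · exact h.1.le
      · intro η η' h
        simp only [Prod.mk.injEq, Subtype.mk.injEq] at h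
        exact Subtype.ext (ofLex.injective (Prod.ext h.1 h.2))
    refine lt_of_le_of_lt hle ?_
    rw [Cardinal.mk_prod, Cardinal.lift_id, Cardinal.lift_id]
    refine Cardinal.mul_lt_of_lt h2 ?_ ?_
    · rw [← Set.Iio_insert]
      refine lt_of_le_of_lt (Cardinal.mk_insert_le) ?_
      refine Cardinal.add_lt_of_lt h2 ?_ (Cardinal.one_lt_aleph0.trans_le h2)
      exact Cardinal.mk_Iio_toType_ord_lt _
    · have : #(WithTop (#I).ord.ToType) = #I + 1 := by
        refine (Cardinal.mk_option).trans ?_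
        rw [Cardinal.mk_toType, Cardinal.card_ord]
      rw [this, Cardinal.add_one_eq hI]
      exact hlt
  let task : Ω → Set (Set I × B) → Set (Set I × B) → Prop := fun ξ R R' =>
    match t (ofLex ξ).1, (ofLex ξ).2 with
    | Sum.inl A0, some x => ∃ b, (A0 (u x), b) ∈ R' ∧ ((A0 (u x))ᶜ, bᶜ) ∈ R'
    | Sum.inl A0, none => (∀ s t, s ⊆ t → A0 t ⊆ A0 s) → A0 ∅ = Set.univ →
      (∃ A1 : I → B, (∀ i, A1 i ∈ U) ∧ ∀ s : Finset I, ∃ b, s.inf A1 ≤ b ∧ (A0 s, b) ∈ R) →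
      ∃ Bf : I → Set I, (∀ α, {i | α ∈ Bf i}.Finite) ∧
        (∀ s : Finset I, (⋂ i ∈ s, Bf i) ⊆ A0 s) ∧ ∀ i, ∃ b ∈ U, (Bf i, b) ∈ R'
    | Sum.inr Q, _ => ∃ f : B → Set I, IsHom f ∧
      ∀ s, (f (Cd Q s), Cd Q s) ∈ R' ∧ ((f (Cd Q s))ᶜ, (Cd Q s)ᶜ) ∈ R'
  obtain ⟨pre, post, R, hR, hpre, hpost, hpp, htask⟩ := transfinite (B := B) (g := g) (Ω := Ω) #I hI hcc
    hseg (by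
      refine ⟨rfl, ?_, ?_⟩
      · intro x y x' y' h1 h2
        rw [Set.mem_singleton_iff, Prod.mk.injEq] at h1 h2 ⊢
        simp [h1, h2]
      · intro x y h1 D _ k hk
        rw [Set.mem_singleton_iff, Prod.mk.injEq] at h1
        obtain ⟨α, hα⟩ := hg D k
        obtain ⟨γ, hγ, hne⟩ := hk α (by rw [h1.1]; trivial)
        exact absurd (hα γ hγ) hne) task (by
      intro ξ R S hSt hS
      have hfr := exists_fresh (Γ := Set I) (Cardinal.mk_set) hS
      obtain ⟨⟨a, x⟩, rfl⟩ := toLex.surjective ξ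
      rcases hta : t a with A0 | Q
      · cases x with
        | top =>
          by_cases hh : (∀ s t, s ⊆ t → A0 t ⊆ A0 s) ∧ A0 ∅ = Set.univ ∧
              (∃ A1 : I → B, (∀ i, A1 i ∈ U) ∧ ∀ s : Finset I, ∃ b, s.inf A1 ≤ b ∧ (A0 s, b) ∈ R)
          · obtain ⟨h1, h2, A1, h3, h4⟩ := hh
            obtain ⟨R', S', k1, k2, k3, k4, k5⟩ := step_solve hSt hfr e1 e1.surjective U A0 h1 h2 A1 h3 h4
            refine ⟨R', S', k1, k2, k3, k4, ?_⟩
            simp only [task, ofLex_toLex, hta]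
            exact fun _ _ _ => k5
          · refine ⟨R, S, le_rfl, le_rfl, hSt, (small_singleton (∅ : Set I)).mono (by simp), ?_⟩
            simp only [task, ofLex_toLex, hta]
            exact fun h1 h2 h3 => absurd ⟨h1, h2, h3⟩ hh
        | coe x =>
          obtain ⟨R', S', k1, k2, k3, k4, k5⟩ := step_decide hSt (A0 (u x))
          refine ⟨R', S', k1, k2, k3, k4, ?_⟩
          simp only [task, ofLex_toLex, hta]
          exact k5
      · obtain ⟨R', S', k1, k2, k3, k4, k5⟩ := step_lift hSt hfr e2 e2.surjective hB (Cd Q)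
        refine ⟨R', S', k1, k2, k3, k4, ?_⟩
        simp only [task, ofLex_toLex, hta]
        exact k5)
  obtain ⟨j, hj, hjR⟩ := sik R hR
  refine ⟨j, hj, ?_, ?_⟩
  · intro A0 h1 h2 ⟨A1, h3, h4⟩
    have hdec : ∀ s, (A0 s, j (A0 s)) ∈ pre (toLex (t.symm (Sum.inl A0), ⊤)) := by
      intro s
      have hts := htask (toLex (t.symm (Sum.inl A0), ((u.symm s : (#I).ord.ToType) : WithTop _)))
      simp only [task, ofLex_toLex, Equiv.apply_symm_apply] at hts
      obtain ⟨b, hb1, hb2⟩ := hts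
      have hb := hj.eq_of_le (hjR _ _ (hpost _ hb1)) (hjR _ _ (hpost _ hb2))
      rw [hb]
      refine hpp _ _ ?_ hb1
      rw [Prod.Lex.lt_iff]
      exact Or.inr ⟨rfl, WithTop.coe_lt_top _⟩
    have hts := htask (toLex (t.symm (Sum.inl A0), ⊤))
    simp only [task, ofLex_toLex, Equiv.apply_symm_apply] at hts
    obtain ⟨Bf, k1, k2, k3⟩ := hts h1 h2 ⟨A1, h3, fun s => ⟨_, h4 s, hdec s⟩⟩
    refine ⟨Bf, k1, k2, fun i => ?_⟩
    obtain ⟨b, hb, hbR⟩ := k3 i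
    exact hU.1.2.2.1 _ _ hb (hjR _ _ (hpost _ hbR))
  · intro Q
    have hts := htask (toLex (t.symm (Sum.inr Q), ⊤))
    simp only [task, ofLex_toLex, Equiv.apply_symm_apply] at hts
    obtain ⟨f, hf, hfs⟩ := hts
    exact ⟨f, hf, fun s => hj.eq_of_le (hjR _ _ (hpost _ (hfs s).1)) (hjR _ _ (hpost _ (hfs s).2))⟩

end UPB

namespace UPB
section MT
variable {L : FirstOrder.Language.{0, 0}} {B : Type} [CompleteBooleanAlgebra B]

/-- Finite conjunctions. -/
noncomputable def fconj {X ι : Type} {n : ℕ} (s : Finset ι) (Φ : ι → L.BoundedFormula X n) : L.BoundedFormula X n :=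
  listConj (s.toList.map Φ)

theorem realize_listConj {X : Type} {n : ℕ} {N : Type} [L.Structure N] (l : List (L.BoundedFormula X n))
    (v : X → N) (xs : Fin n → N) : (listConj l).Realize v xs ↔ ∀ φ ∈ l, φ.Realize v xs := by
  induction l with
  | nil => simp [listConj]
  | cons a l ih => simp [listConj, ih]

theorem realize_fconj {X ι : Type} {n : ℕ} {N : Type} [L.Structure N] (s : Finset ι)
    (Φ : ι → L.BoundedFormula X n) (v : X → N) (xs : Fin n → N) :
    (fconj s Φ).Realize v xs ↔ ∀ i ∈ s, (Φ i).Realize v xs := by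
  simp [fconj, realize_listConj]

theorem realize_fconj' {X ι : Type} {N : Type} [L.Structure N] (s : Finset ι)
    (Φ : ι → L.Formula X) (v : X → N) :
    Formula.Realize (fconj s Φ : L.Formula X) v ↔ ∀ i ∈ s, (Φ i).Realize v :=
  realize_fconj s Φ v _

/-- A structure with an assignment. -/
structure World (L : FirstOrder.Language.{0, 0}) (X : Type) : Type 1 where
  N : Type
  [str : L.Structure N]
  [ne : Nonempty N]
  v : X → N

attribute [instance] World.str World.ne

theorem compact {X : Type} (S : Set (L.Formula X))
    (h : ∀ s : Finset (L.Formula X), (s : Set (L.Formula X)) ⊆ S →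
      ∃ w : World L X, ∀ φ ∈ s, φ.Realize w.v) :
    ∃ w : World L X, ∀ φ ∈ S, φ.Realize w.v := by
  classical
  have hsat : Theory.IsSatisfiable (L := L[[X]]) (Formula.equivSentence '' S) := by
    rw [Theory.isSatisfiable_iff_isFinitelySatisfiable]
    intro T0 hT0
    obtain ⟨w, hw⟩ := h (T0.image Formula.equivSentence.symm) (by
      intro φ hφ
      rw [Finset.mem_coe, Finset.mem_image] at hφ
      obtain ⟨σ, hσ, rfl⟩ := hφ
      obtain ⟨ψ, hψ, rfl⟩ := hT0 hσ
      simpa using hψ)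
    letI := constantsOn.structure w.v
    have : w.N ⊨ (T0 : (L[[X]]).Theory) := by
      rw [Theory.model_iff]
      intro σ hσ
      have := hw _ (Finset.mem_image_of_mem _ hσ)
      rwa [Formula.realize_equivSentence_symm] at this
    exact Theory.Model.isSatisfiable w.N
  obtain ⟨M⟩ := hsat
  letI : L.Structure M := (L.lhomWithConstants X).reduct M
  haveI : (L.lhomWithConstants X).IsExpansionOn M := LHom.isExpansionOn_reduct _ _
  refine ⟨⟨M, fun a => (L.con a : M)⟩, fun φ hφ => ?_⟩
  have := M.is_model.realize_of_mem _ (Set.mem_image_of_mem _ hφ)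
  rwa [Formula.realize_equivSentence] at this

/-- Boolean valuations of formulas. -/
structure IsVal {X : Type} (F : L.Formula X → B) : Prop where
  valid : ∀ φ : L.Formula X, (∀ w : World L X, φ.Realize w.v) → F φ = ⊤
  not : ∀ φ : L.Formula X, F φ.not = (F φ)ᶜ
  inf : ∀ φ ψ : L.Formula X, F (φ ⊓ ψ) = F φ ⊓ F ψ

theorem isVal_of_bval {X : Type} {F : L.Formula X → B} (h : IsBVal F) : IsVal F :=
  ⟨fun φ hφ => h.1 φ fun N _ _ v => hφ ⟨N, v⟩, h.2.1, h.2.2.1⟩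

namespace IsVal
variable {X : Type} {F : L.Formula X → B}

theorem mono (h : IsVal F) {φ ψ : L.Formula X} (hh : ∀ w : World L X, φ.Realize w.v → ψ.Realize w.v) :
    F φ ≤ F ψ := by
  have := h.valid (φ ⊓ ψ.not).not (by
    intro w
    rw [Formula.realize_not, Formula.realize_inf, Formula.realize_not]
    exact fun h => h.2 (hh w h.1))
  rw [h.not, h.inf, h.not, compl_eq_top, ← disjoint_iff, disjoint_compl_right_iff] at this
  exact this

theorem congr (h : IsVal F) {φ ψ : L.Formula X} (hh : ∀ w : World L X, φ.Realize w.v ↔ ψ.Realize w.v) :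
    F φ = F ψ :=
  le_antisymm (h.mono fun w => (hh w).1) (h.mono fun w => (hh w).2)

theorem top (h : IsVal F) : F ⊤ = ⊤ := h.valid _ fun w => by simp

theorem conj (h : IsVal F) {ι : Type} (s : Finset ι) (Φ : ι → L.Formula X) :
    F (fconj s Φ) = s.inf fun i => F (Φ i) := by
  classical
  induction s using Finset.induction_on with
  | empty => exact (h.congr fun w => by rw [realize_fconj']; simp).trans h.top
  | insert a s ha ih =>
    rw [Finset.inf_insert, ← ih, ← h.inf]
    refine h.congr fun w => ?_
    rw [realize_fconj', Formula.realize_inf, realize_fconj']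
    simp

theorem relabel (h : IsVal F) {Y : Type} (f : Y → X) : IsVal fun φ : L.Formula Y => F (φ.relabel f) := by
  refine ⟨fun φ hφ => ?_, fun φ => ?_, fun φ ψ => ?_⟩
  · exact h.valid _ fun w => Formula.realize_relabel.mpr (hφ ⟨w.N, w.v ∘ f⟩)
  · rw [← h.not]
    refine h.congr fun w => ?_
    rw [Formula.realize_relabel, Formula.realize_not, Formula.realize_not, Formula.realize_relabel]
  · rw [← h.inf]
    refine h.congr fun w => ?_
    simp [Formula.realize_relabel, Formula.realize_inf]

theorem exists_world (h : IsVal F) {φ : L.Formula X} (hφ : F φ ≠ ⊥) : ∃ w : World L X, φ.Realize w.v := by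
  by_contra hcon
  push Not at hcon
  have := h.valid φ.not fun w => hcon w
  rw [h.not, compl_eq_top] at this
  exact hφ this

/-- The world associated with an ultrafilter. -/
theorem ultra (h : IsVal F) {U : Set B} (hU : IsBUltrafilter U) :
    ∃ w : World L X, ∀ φ, F φ ∈ U ↔ φ.Realize w.v := by
  obtain ⟨w, hw⟩ := compact {φ | F φ ∈ U} (by
    intro s hs
    have : F (fconj s id) ∈ U := by
      rw [h.conj, ult_finset hU]
      exact fun φ hφ => hs hφ
    obtain ⟨w, hw⟩ := h.exists_world (φ := fconj s id) (fun h0 => hU.1.2.1 (h0 ▸ this))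
    rw [realize_fconj'] at hw
    exact ⟨w, hw⟩)
  refine ⟨w, fun φ => ⟨hw φ, fun hφ => ?_⟩⟩
  by_contra hcon
  have := hw φ.not (by
    change F φ.not ∈ U
    rw [h.not, ult_compl hU]
    exact hcon)
  exact this hφ

theorem le_of_worlds (h : IsVal F) {φ ψ : L.Formula X} (hh : ∀ w : World L X,
    (∀ θ, F θ = ⊤ → θ.Realize w.v) → φ.Realize w.v → ψ.Realize w.v) : F φ ≤ F ψ := by
  by_contra hcon
  have hne : F φ ⊓ (F ψ)ᶜ ≠ ⊥ := by
    intro h0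
    rw [← disjoint_iff, disjoint_compl_right_iff] at h0
    exact hcon h0
  obtain ⟨V, hV, hm⟩ := exists_ult _ hne
  obtain ⟨w, hw⟩ := h.ultra hV
  rw [ult_inf hV, ult_compl hV, hw, hw] at hm
  exact hm.2 (hh w (fun θ hθ => (hw θ).1 (hθ ▸ hV.1.1)) hm.1)

theorem eq_of_worlds (h : IsVal F) {φ ψ : L.Formula X} (hh : ∀ w : World L X,
    (∀ θ, F θ = ⊤ → θ.Realize w.v) → (φ.Realize w.v ↔ ψ.Realize w.v)) : F φ = F ψ :=
  le_antisymm (h.le_of_worlds fun w hw => (hh w hw).1) (h.le_of_worlds fun w hw => (hh w hw).2)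

end IsVal

/-- Existence of valuations satisfying constraints. -/
theorem exists_val {X : Type} (K : Set (World L X)) {ι : Type} (φ : ι → L.Formula X) (b : ι → B)
    (i0 : ι) (hi0 : b i0 = ⊤)
    (dir : ∀ i j, ∃ k, b i ⊓ b j ≤ b k ∧ ∀ w ∈ K, (φ k).Realize w.v → (φ i).Realize w.v ∧ (φ j).Realize w.v)
    (cons : ∀ i, b i ≠ ⊥ → ∃ w ∈ K, (φ i).Realize w.v) :
    ∃ F : L.Formula X → B, IsVal F ∧ (∀ ψ : L.Formula X, (∀ w ∈ K, ψ.Realize w.v) → F ψ = ⊤) ∧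
      ∀ i, b i ≤ F (φ i) := by
  let den : L.Formula X → Set K := fun ψ => {w | ψ.Realize w.1.v}
  obtain ⟨G, hG, hGR⟩ := sik {q : Set K × B | ∃ i, q.2 ≤ b i ∧ den (φ i) ⊆ q.1} (by
    refine ⟨⟨i0, by rw [hi0], fun _ _ => trivial⟩, ?_, ?_⟩
    · rintro x y x' y' ⟨i, h1, h2⟩ ⟨j, h1', h2'⟩
      obtain ⟨k, hk, hk'⟩ := dir i j
      exact ⟨k, (inf_le_inf h1 h1').trans hk, fun w hw =>
        ⟨h2 (hk' w.1 w.2 hw).1, h2' (hk' w.1 w.2 hw).2⟩⟩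
    · rintro y ⟨i, h1, h2⟩
      by_contra hy
      obtain ⟨w, hw, hw'⟩ := cons i (fun h0 => hy (eq_bot_iff.mpr (h0 ▸ h1)))
      exact h2 (show (⟨w, hw⟩ : K) ∈ den (φ i) from hw'))
  refine ⟨fun ψ => G (den ψ), ⟨?_, ?_, ?_⟩, ?_, ?_⟩
  · intro ψ hψ
    have : den ψ = ⊤ := Set.eq_univ_of_forall fun w => hψ w.1
    rw [this, hG.top]
  · intro ψ
    rw [← hG.compl]
    rfl
  · intro ψ ψ'
    rw [← hG.inf]
    congr 1
    ext w
    exact Formula.realize_inf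
  · intro ψ hψ
    have : den ψ = ⊤ := Set.eq_univ_of_forall fun w => hψ w.1 w.2
    change G (den ψ) = ⊤
    rw [this, hG.top]
  · intro i
    exact hGR _ _ ⟨i, le_rfl, le_rfl⟩

theorem realize_plugEmb {C D : Type} {k : ℕ} (φ : L.BoundedFormula C k) (e : C → D) (b : Fin k → D)
    {N : Type} [L.Structure N] (v : D → N) :
    (plugEmb φ e b).Realize v ↔ φ.Realize (v ∘ e) (v ∘ b) := by
  rw [plugEmb, Formula.realize_relabel, BoundedFormula.realize_toFormula]
  rfl

theorem realize_plug {C : Type} {k : ℕ} (φ : L.BoundedFormula C k) (b : Fin k → C)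
    {N : Type} [L.Structure N] (v : C → N) :
    (plug φ b).Realize v ↔ φ.Realize v (v ∘ b) := by
  rw [plug, realize_plugEmb]; rfl

theorem realize_ex1 {C : Type} (φ : L.BoundedFormula C 1) {N : Type} [L.Structure N] (v : C → N) :
    Formula.Realize (φ.ex : L.Formula C) v ↔ ∃ a, φ.Realize v (fun _ => a) := by
  rw [Formula.Realize, BoundedFormula.realize_ex]
  refine exists_congr fun a => ?_
  have : (Fin.snoc default a : Fin 1 → N) = fun _ => a := by
    funext i
    have hi : i = Fin.last 0 := Subsingleton.elim (α := Fin 1) _ _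
    rw [hi, Fin.snoc_last]
  rw [this]

/-- Reduction to finitely many variables. -/
theorem fin_red {C : Type} (φ : L.BoundedFormula C 1) :
    ∃ (n : ℕ) (φ' : L.BoundedFormula (Fin n) 1) (ys : Fin n → C),
      ∀ (N : Type) [L.Structure N] (v : C → N) (xs : Fin 1 → N),
        φ.Realize v xs ↔ φ'.Realize (v ∘ ys) xs := by
  classical
  let e := φ.freeVarFinset.equivFin
  refine ⟨_, φ.restrictFreeVar e, fun i => (e.symm i).1, fun N _ v xs => ?_⟩
  exact (BoundedFormula.realize_restrictFreeVar v (by simp)).symm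

/-- Existential quantification over arbitrarily many variables. -/
theorem ex_red {X Y : Type} (χ : L.Formula (X ⊕ Y)) :
    ∃ θ : L.Formula X, ∀ (N : Type) [L.Structure N] [Nonempty N] (v : X → N),
      θ.Realize v ↔ ∃ w : Y → N, χ.Realize (Sum.elim v w) := by
  classical
  let J : Finset Y := χ.freeVarFinset.preimage Sum.inr Sum.inr_injective.injOn
  have hJ : ∀ y : Y, Sum.inr y ∈ χ.freeVarFinset → y ∈ J := fun y hy => by simpa [J] using hy
  let f : χ.freeVarFinset → X ⊕ J := fun a =>
    match a with
    | ⟨Sum.inl x, _⟩ => Sum.inl x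
    | ⟨Sum.inr y, hy⟩ => Sum.inr ⟨y, hJ y hy⟩
  let χ' : L.Formula (X ⊕ J) := χ.restrictFreeVar f
  refine ⟨χ'.iExs J, fun N _ _ v => ?_⟩
  rw [Formula.realize_iExs]
  constructor
  · rintro ⟨i, hi⟩
    refine ⟨fun y => if hy : y ∈ J then i ⟨y, hy⟩ else Classical.arbitrary N, ?_⟩
    refine (BoundedFormula.realize_restrictFreeVar _ ?_).1 hi
    rintro ⟨x | y, h⟩
    · rfl
    · simp [f, hJ y h]
  · rintro ⟨w, hw⟩
    refine ⟨fun y => w y.1, ?_⟩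
    refine (BoundedFormula.realize_restrictFreeVar (Sum.elim v w) ?_).2 hw
    rintro ⟨x | y, h⟩ <;> rfl

/-- Witness property. -/
def Wit {X : Type} (F : L.Formula X → B) : Prop :=
  ∀ (n : ℕ) (φ : L.BoundedFormula (Fin n) 1) (ys : Fin n → X),
    ∃ a, F (Formula.relabel ys (φ.ex : L.Formula (Fin n))) ≤ F (plugEmb φ ys fun _ => a)

theorem Wit.ex {X : Type} {F : L.Formula X → B} (hF : IsVal F) (hw : Wit F) (φ : L.BoundedFormula X 1) :
    ∃ a, F φ.ex ≤ F (plug φ fun _ => a) := by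
  obtain ⟨n, φ', ys, h⟩ := fin_red φ
  obtain ⟨a, ha⟩ := hw n φ' ys
  refine ⟨a, le_trans (hF.mono fun w hw => ?_) (ha.trans (hF.mono fun w hw => ?_))⟩
  · rw [Formula.realize_relabel, realize_ex1]
    rw [realize_ex1] at hw
    obtain ⟨x, hx⟩ := hw
    exact ⟨x, (h _ _ _).1 hx⟩
  · rw [realize_plugEmb] at hw
    rw [realize_plug]
    exact (h _ _ _).2 hw

theorem IsFull.wit {X : Type} {F : L.Formula X → B} (hF : IsVal F) (hf : IsFull F) : Wit F := by
  intro n φ ys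
  obtain ⟨a, ha⟩ := hf (φ.subst fun i => Term.var (ys i))
  refine ⟨a, le_trans (hF.mono fun w hw => ?_) (ha.le.trans (hF.mono fun w hw => ?_))⟩
  · rw [Formula.realize_relabel, realize_ex1] at hw
    rw [realize_ex1]
    obtain ⟨x, hx⟩ := hw
    exact ⟨x, BoundedFormula.realize_subst.2 hx⟩
  · rw [realize_plug, BoundedFormula.realize_subst] at hw
    rw [realize_plugEmb]
    exact hw

/-- Quotienting a valuation with witnesses to get a full Boolean-valued structure. -/
theorem quot {X : Type} {F : L.Formula X → B} (hF : IsVal F) (hw : Wit F) :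
    ∃ (C : Type) (val : L.Formula C → B) (q : X → C), Function.Surjective q ∧ IsBVal val ∧ IsFull val ∧
      ∀ φ : L.Formula X, val (φ.relabel q) = F φ := by
  have key : ∀ a b : X, F (Term.equal (Term.var a) (Term.var b)) = ⊤ →
      ∀ w : World L X, (∀ θ, F θ = ⊤ → θ.Realize w.v) → w.v a = w.v b := by
    intro a b h w hw
    have := hw _ h
    simpa using this
  let s : Setoid X :=
    { r := fun a b => F (Term.equal (Term.var a) (Term.var b)) = ⊤
      iseqv := by
        refine ⟨fun a => hF.valid _ fun w => by simp, fun {a b} h => ?_, fun {a b c} h h' => ?_⟩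
        · rw [eq_top_iff, ← hF.top]
          exact hF.le_of_worlds fun w hw _ => by simpa using (key _ _ h w hw).symm
        · rw [eq_top_iff, ← hF.top]
          exact hF.le_of_worlds fun w hw _ => by
            simpa using (key _ _ h w hw).trans (key _ _ h' w hw) }
  let q : X → Quotient s := Quotient.mk s
  have hrel : ∀ (Y : Type) (φ : L.Formula Y) (f : Y → X),
      F (φ.relabel fun x => (q (f x)).out) = F (φ.relabel f) := by
    intro Y φ f
    refine hF.eq_of_worlds fun w hw => ?_
    rw [Formula.realize_relabel, Formula.realize_relabel]
    have : (w.v ∘ fun x => (q (f x)).out) = w.v ∘ f := funext fun x =>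
      key _ _ (Quotient.mk_out (s := s) (f x)) w hw
    rw [this]
  have hval : IsVal fun φ : L.Formula (Quotient s) => F (φ.relabel Quotient.out) := hF.relabel _
  have hcomm : ∀ φ : L.Formula X, F ((φ.relabel q).relabel Quotient.out) = F φ := by
    intro φ
    have h1 : F ((φ.relabel q).relabel Quotient.out) = F (φ.relabel fun x => (q x).out) :=
      hF.congr fun w => by simp only [Formula.realize_relabel]; rfl
    rw [h1, hrel X φ fun x => x]
    exact hF.congr fun w => by simp only [Formula.realize_relabel]; rfl
  have hex : ∀ φ : L.BoundedFormula (Quotient s) 1, ∃ a : Quotient s,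
      F (Formula.relabel Quotient.out (φ.ex : L.Formula (Quotient s))) =
        F ((plug φ fun _ => a).relabel Quotient.out) := by
    intro φ
    obtain ⟨a, ha⟩ := hw.ex hF (φ.subst fun c => Term.var c.out)
    refine ⟨q a, le_antisymm ?_ ?_⟩
    · refine le_trans (hF.mono fun w hw => ?_) (ha.trans (hF.le_of_worlds fun w hw hw' => ?_))
      · rw [Formula.realize_relabel, realize_ex1] at hw
        rw [realize_ex1]
        obtain ⟨x, hx⟩ := hw
        exact ⟨x, BoundedFormula.realize_subst.2 hx⟩
      · rw [realize_plug, BoundedFormula.realize_subst] at hw'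
        rw [Formula.realize_relabel, realize_plug]
        have : ((w.v ∘ Quotient.out) ∘ fun _ : Fin 1 => q a) = w.v ∘ fun _ => a := funext fun _ =>
          key _ _ (Quotient.mk_out (s := s) a) w hw
        rw [this]
        exact hw'
    · refine hF.mono fun w hw => ?_
      rw [Formula.realize_relabel, realize_plug] at hw
      rw [Formula.realize_relabel, realize_ex1]
      exact ⟨_, hw⟩
  refine ⟨Quotient s, fun φ => F (φ.relabel Quotient.out), q, Quotient.mk_surjective,
    ⟨fun φ hφ => hval.valid φ fun w => hφ w.N w.v, hval.not, hval.inf, ?_, ?_⟩, ?_, hcomm⟩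
  · intro φ
    apply le_antisymm
    · obtain ⟨a, ha⟩ := hex φ
      refine ha.le.trans ?_
      exact le_iSup (fun a => F ((plug φ fun _ => a).relabel Quotient.out)) a
    · refine iSup_le fun a => hF.mono fun w hw => ?_
      rw [Formula.realize_relabel, realize_plug] at hw
      rw [Formula.realize_relabel, realize_ex1]
      exact ⟨_, hw⟩
  · intro a b hab
    rw [lt_top_iff_ne_top]
    intro h
    apply hab
    rw [← Quotient.out_eq a, ← Quotient.out_eq b]
    apply Quotient.sound
    change F _ = ⊤
    rw [← h]
    exact hF.congr fun w => by simp [Formula.realize_relabel]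
  · exact hex

end MT
end UPB

namespace UPB
section MT2
variable {L : FirstOrder.Language.{0, 0}} {B : Type} [CompleteBooleanAlgebra B]

/-- Existence of specializations. -/
theorem exists_spec {C : Type} {val : L.Formula C → B} (hv : IsVal val) (hf : IsFull val) {U : Set B}
    (hU : IsBUltrafilter U) : ∃ (N : Type) (_ : L.Structure N) (π : C → N), IsSpecialization val U N π := by
  classical
  obtain ⟨w, hw⟩ := hv.ultra hU
  have wit := IsFull.wit hv hf
  have wit' : ∀ (n : ℕ) (φ : L.BoundedFormula (Fin n) 1) (ys : Fin n → C),
      (∃ a, φ.Realize (w.v ∘ ys) fun _ => a) → ∃ c, φ.Realize (w.v ∘ ys) fun _ => w.v c := by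
    intro n φ ys h
    obtain ⟨c, hc⟩ := wit n φ ys
    refine ⟨c, ?_⟩
    have h1 : val (Formula.relabel ys (φ.ex : L.Formula (Fin n))) ∈ U := by
      rw [hw, Formula.realize_relabel, realize_ex1]
      exact h
    have h2 := hU.1.2.2.1 _ _ h1 hc
    rw [hw, realize_plugEmb] at h2
    exact h2
  let S : L.Substructure w.N :=
    { carrier := Set.range w.v
      fun_mem := by
        intro n f xs hxs
        choose ys hys using hxs
        have hys' : w.v ∘ ys = xs := funext hys
        obtain ⟨c, hc⟩ := wit' n
          ((Term.func f fun i => Term.var (Sum.inl i)).bdEqual (Term.var (Sum.inr 0))) ys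
          ⟨Structure.funMap f xs, by simp [hys']⟩
        rw [hys'] at hc
        simp only [BoundedFormula.realize_bdEqual, Term.realize_func, Term.realize_var,
          Sum.elim_inl, Sum.elim_inr] at hc
        exact ⟨c, hc.symm⟩ }
  have hS : S.IsElementary := by
    apply S.isElementary_of_exists
    intro n φ x a ha
    have hx : ∀ i, ∃ c, w.v c = (x i : w.N) := fun i => (x i).2
    choose ys hys using hx
    have hys' : w.v ∘ ys = ((↑) ∘ x) := funext hys
    let φ' : L.BoundedFormula (Fin n) 1 :=
      BoundedFormula.relabel (fun z : Empty ⊕ Fin (n + 1) =>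
        (Sum.elim (fun e => e.elim) (fun i => Fin.lastCases (Sum.inr (0 : Fin 1)) (fun j => Sum.inl j) i) z : Fin n ⊕ Fin 1)) φ.toFormula
    have hφ' : ∀ (v : Fin n → w.N) (b : w.N), φ'.Realize v (fun _ => b) ↔ φ.Realize default (Fin.snoc v b : _ → w.N) := by
      intro v b
      refine (BoundedFormula.realize_relabel (M := w.N)).trans ?_
      have := BoundedFormula.realize_toFormula (M := w.N) φ (Sum.elim default (Fin.snoc v b))
      rw [Sum.elim_comp_inl, Sum.elim_comp_inr] at this
      rw [← this]
      have e1 : (Sum.elim v ((fun _ : Fin (1 + 0) => b) ∘ Fin.castAdd 0) ∘ fun z : Empty ⊕ Fin (n + 1) =>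
        (Sum.elim (fun e => e.elim) (fun i => Fin.lastCases (Sum.inr (0 : Fin 1)) (fun j => Sum.inl j) i) z : Fin n ⊕ Fin 1))
          = Sum.elim default (Fin.snoc v b) := by
        funext z
        rcases z with z | z
        · exact z.elim
        · refine Fin.lastCases ?_ (fun j => ?_) z
          · simp
          · simp
      rw [e1, Formula.Realize]
      have e2 : ((fun _ : Fin (1 + 0) => b) ∘ Fin.natAdd 1 : Fin 0 → w.N) = default := Subsingleton.elim _ _
      rw [e2]
    obtain ⟨c, hc⟩ := wit' n φ' ys ⟨a, by rw [hφ', hys']; exact ha⟩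
    rw [hφ', hys'] at hc
    exact ⟨⟨w.v c, c, rfl⟩, hc⟩
  refine ⟨S, inferInstance, fun c => ⟨w.v c, c, rfl⟩, ?_, ?_⟩
  · rintro ⟨_, c, rfl⟩
    exact ⟨c, rfl⟩
  · intro φ
    rw [hw]
    let S' : L.ElementarySubstructure w.N := ⟨S, hS⟩
    exact S'.subtype.map_formula φ (fun c => (⟨w.v c, c, rfl⟩ : S'))

/-- The language of Henkin witness functions. -/
def HL (L : FirstOrder.Language.{0, 0}) : FirstOrder.Language.{0, 0} :=
  ⟨fun n => L.BoundedFormula (Fin n) 1, fun _ => Empty⟩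

theorem card_HL {X : Type} (hL : L.card ≤ ℵ₀) {lam : Cardinal} (hlam : ℵ₀ ≤ lam) (hX : #X ≤ lam) :
    #((HL L).Term X) ≤ lam := by
  refine Term.card_le.trans (max_le hlam ?_)
  rw [Cardinal.mk_sum, Cardinal.lift_id, Cardinal.lift_id]
  refine Cardinal.add_le_of_le hlam hX (le_trans ?_ hlam)
  rw [Cardinal.mk_sigma]
  refine (Cardinal.sum_le_sum _ (fun _ => ℵ₀) fun n => ?_).trans (by simp)
  have h1 : #(L.BoundedFormula (Fin n) 1) ≤ #(Σ k, L.BoundedFormula (Fin n) k) :=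
    Cardinal.mk_le_of_injective (f := fun φ => ⟨1, φ⟩) fun a b h => by simpa using h
  refine h1.trans (BoundedFormula.card_le.trans (max_le le_rfl ?_))
  rw [Cardinal.lift_id, Cardinal.lift_id]
  exact Cardinal.add_le_of_le le_rfl (Cardinal.lt_aleph0_of_finite _).le hL

/-- Henkin extension of a valuation. -/
theorem henkin {X : Type} {F : L.Formula X → B} (hF : IsVal F) (hL : L.card ≤ ℵ₀) {lam : Cardinal}
    (hlam : ℵ₀ ≤ lam) (hX : #X ≤ lam) :
    ∃ (C : Type) (val : L.Formula C → B) (κ : X → C), IsBVal val ∧ IsFull val ∧ #C ≤ lam ∧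
      ∀ φ : L.Formula X, val (φ.relabel κ) = F φ := by
  classical
  let Y := (HL L).Term X
  let K : Set (World L Y) := {w | ∀ (n : ℕ) (φ : L.BoundedFormula (Fin n) 1) (ys : Fin n → Y),
    (∃ a, φ.Realize (w.v ∘ ys) fun _ => a) →
      φ.Realize (w.v ∘ ys) fun _ => w.v (Term.func (L := HL L) (show (HL L).Functions n from φ) ys)}
  obtain ⟨F', hF', hK, hle⟩ := exists_val (B := B) K
    (fun φ : L.Formula X => φ.relabel (Term.var : X → Y)) F ⊤ hF.top (by
      intro φ ψ
      refine ⟨φ ⊓ ψ, (hF.inf φ ψ).ge, fun w _ h => ?_⟩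
      simp only [Formula.realize_relabel, Formula.realize_inf] at h ⊢
      exact h) (by
      intro φ hφ
      obtain ⟨w, hw⟩ := hF.exists_world hφ
      let st : (HL L).Structure w.N :=
        { funMap := fun {n} (φ : L.BoundedFormula (Fin n) 1) xs =>
            if h : ∃ a, φ.Realize xs (fun _ => a) then h.choose else Classical.arbitrary _
          RelMap := fun {n} (r : Empty) => r.elim }
      refine ⟨⟨w.N, fun t => t.realize w.v⟩, ?_, ?_⟩
      · intro n φ ys h
        have : Term.realize w.v (Term.func (L := HL L) (show (HL L).Functions n from φ) ys) = h.choose := by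
          rw [Term.realize_func]
          exact dif_pos h
        change φ.Realize _ fun _ => Term.realize w.v (Term.func (L := HL L) (show (HL L).Functions n from φ) ys)
        rw [this]
        exact h.choose_spec
      · rw [Formula.realize_relabel]
        exact hw)
  have heq : ∀ φ : L.Formula X, F' (φ.relabel Term.var) = F φ := by
    intro φ
    apply le_antisymm _ (hle φ)
    have := hle φ.not
    rw [hF.not] at this
    have h2 : F' ((φ.not).relabel (Term.var : X → Y)) = (F' (φ.relabel Term.var))ᶜ :=
      (hF'.relabel _).not φ
    rw [h2] at this
    exact compl_le_compl_iff_le.mp this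
  have hwit : Wit F' := by
    intro n φ ys
    refine ⟨Term.func (L := HL L) (show (HL L).Functions n from φ) ys, ?_⟩
    set c := Term.func (L := HL L) (show (HL L).Functions n from φ) ys with hc
    have := hK ((Formula.relabel ys (φ.ex : L.Formula (Fin n))).imp (plugEmb φ ys fun _ => c)) (by
      intro w hw
      rw [Formula.realize_imp, Formula.realize_relabel, realize_ex1, realize_plugEmb]
      exact hw n φ ys)
    refine hF'.le_of_worlds fun w hw h => ?_
    exact Formula.realize_imp.1 (hw _ this) h
  obtain ⟨C, val, q, hq, h1, h2, h3⟩ := quot hF' hwit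
  refine ⟨C, val, fun x => q (Term.var x), h1, h2,
    (Cardinal.mk_le_of_surjective hq).trans (card_HL hL hlam hX), fun φ => ?_⟩
  rw [← heq, ← h3]
  exact (isVal_of_bval h1).congr fun w => by simp only [Formula.realize_relabel]; rfl

end MT2
end UPB

namespace UPB
section MT3
variable {L : FirstOrder.Language.{0, 0}} {B : Type} [CompleteBooleanAlgebra B] {I : Type}

/-- The formula `∃ x, ⋀ i ∈ s, Φ i`. -/
noncomputable def psi (Φ : I → L.BoundedFormula I 1) (s : Finset I) : L.Formula I :=
  (fconj s Φ).ex

theorem realize_psi (Φ : I → L.BoundedFormula I 1) (s : Finset I) {N : Type} [L.Structure N] (v : I → N) :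
    (psi Φ s).Realize v ↔ ∃ x, ∀ i ∈ s, (Φ i).Realize v fun _ => x := by
  rw [psi, realize_ex1]
  simp only [realize_fconj]

/-- The patterns which are realized in models of `T`. -/
def QT (T : L.Theory) (Φ : I → L.BoundedFormula I 1) : Set (Pat I) :=
  {p | ∃ w : World L I, w.N ⊨ T ∧ (∀ s ∈ p.1, (psi Φ s).Realize w.v) ∧
    ∀ s ∈ p.2, ¬ (psi Φ s).Realize w.v}

theorem model_of {X : Type} {T : L.Theory} (w : World L X)
    (h : ∀ φ ∈ T, (Formula.relabel (fun e : Empty => (e.elim : X)) φ).Realize w.v) : w.N ⊨ T := by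
  rw [Theory.model_iff]
  intro φ hφ
  have := h φ hφ
  rw [Formula.realize_relabel] at this
  rw [Sentence.Realize]
  convert this using 1

theorem of_model {X : Type} {T : L.Theory} (w : World L X) (h : w.N ⊨ T) :
    ∀ φ ∈ T, (Formula.relabel (fun e : Empty => (e.elim : X)) φ).Realize w.v := by
  intro φ hφ
  have := Theory.model_iff T |>.1 h φ hφ
  rw [Formula.realize_relabel]
  rw [Sentence.Realize] at this
  convert this using 1

theorem bmodels_iff {C D : Type} {v : L.Formula C → B} {w : L.Formula D → B} {f : C → D}
    (hw : IsVal w) (h : ElemMap v w f) (T : L.Theory) : BModels v T ↔ BModels w T := by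
  refine forall_congr' fun φ => forall_congr' fun _ => ?_
  rw [h]
  have : w (Formula.relabel f (Formula.relabel (fun e : Empty => e.elim) φ)) =
      w (Formula.relabel (fun e : Empty => e.elim) φ) := hw.congr fun x => by
    simp only [Formula.realize_relabel]
    rw [Subsingleton.elim ((x.v ∘ f) ∘ fun e : Empty => e.elim) (x.v ∘ fun e : Empty => e.elim)]
  rw [this]

theorem val_conservative {X Y : Type} {F : L.Formula X → B} {G : L.Formula Y → B} (hF : IsVal F)
    (hG : IsVal G) (f : X → Y) (h : ∀ φ : L.Formula X, F φ ≤ G (φ.relabel f)) (φ : L.Formula X) :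
    G (φ.relabel f) = F φ := by
  apply le_antisymm _ (h φ)
  have := h φ.not
  rw [hF.not] at this
  have h2 : G ((φ.not).relabel f) = (G (φ.relabel f))ᶜ := (hG.relabel f).not φ
  rw [h2] at this
  exact compl_le_compl_iff_le.mp this

theorem pval_mem {U : Set B} (hU : IsBUltrafilter U) (A : Finset I → B) (p : Pat I) :
    pval A p ∈ U ↔ (∀ s ∈ p.1, A s ∈ U) ∧ ∀ s ∈ p.2, A s ∉ U := by
  rw [pval, ult_inf hU, ult_finset hU, ult_finset hU]
  simp only [ult_compl hU]

theorem mt_back [Infinite I] (hL : L.card ≤ ℵ₀) (T : L.Theory) {U : Set B} (hU : IsBUltrafilter U)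
    (h : ∀ (Φ : I → L.BoundedFormula I 1) (A : Finset I → B), Compat (QT T Φ) A → (∀ s, A s ∈ U) →
      HasMR U A) : Saturates U T #I := by
  classical
  intro C val hM hsat N _ π hπ A hA p hp
  have hI : ℵ₀ ≤ #I := Cardinal.aleph0_le_mk I
  have hval := isVal_of_bval hM.1
  obtain ⟨n0, -⟩ := hp ∅ (by simp)
  rcases p.eq_empty_or_nonempty with rfl | hpne
  · exact ⟨n0, by simp⟩
  have hp_card : #p ≤ #I := by
    refine (Cardinal.mk_set_le p).trans ?_
    have h1 : #(L.BoundedFormula A 1) ≤ #(Σ k, L.BoundedFormula A k) :=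
      Cardinal.mk_le_of_injective (f := fun φ => ⟨1, φ⟩) fun a b h => by simpa using h
    refine h1.trans (BoundedFormula.card_le.trans (max_le hI ?_))
    rw [Cardinal.lift_id, Cardinal.lift_id]
    exact Cardinal.add_le_of_le hI hA (hL.trans hI)
  obtain ⟨eA⟩ := hA
  obtain ⟨ep⟩ := hp_card
  haveI : Nonempty p := hpne.to_subtype
  let φi : I → p := Function.invFun ep
  have hφi : Function.Surjective φi := Function.invFun_surjective ep.injective
  obtain ⟨c0, -⟩ := hπ.1 n0
  let w : I → C := Function.extend eA (fun a => Function.surjInv hπ.1 a.1) fun _ => c0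
  have hw : ∀ a : A, π (w (eA a)) = a.1 := by
    intro a
    rw [show w (eA a) = _ from eA.injective.extend_apply _ _ a]
    exact Function.surjInv_eq hπ.1 _
  let Φ : I → L.BoundedFormula I 1 := fun i => (φi i).1.subst fun a => Term.var (eA a)
  have hΦ : ∀ i (N' : Type) [L.Structure N'] (v : I → N') (xs : Fin 1 → N'),
      (Φ i).Realize v xs ↔ (φi i).1.Realize (v ∘ eA) xs := by
    intro i N' _ v xs
    exact BoundedFormula.realize_subst
  have hπw : (π ∘ w) ∘ eA = Subtype.val := funext hw
  let A0 : Finset I → B := fun s => val ((psi Φ s).relabel w)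
  obtain ⟨a, haU, ha⟩ := h Φ A0 (by
    intro pt hpt
    by_contra hne
    obtain ⟨V, hV, hm⟩ := exists_ult _ hne
    obtain ⟨x, hx⟩ := hval.ultra hV
    rw [pval_mem hV] at hm
    apply hpt
    refine ⟨⟨x.N, x.v ∘ w⟩, ?_, ?_, ?_⟩
    · refine model_of x fun φ hφ => ?_
      rw [← hx, hM.2.2 φ hφ]
      exact hV.1.1
    · intro s hs
      have := hm.1 s hs
      rw [hx, Formula.realize_relabel] at this
      exact this
    · intro s hs
      have := hm.2 s hs
      rw [hx, Formula.realize_relabel] at this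
      exact this) (by
    intro s
    change val _ ∈ U
    rw [hπ.2, Formula.realize_relabel, realize_psi]
    obtain ⟨b, hb⟩ := hp (s.image fun i => (φi i).1) (by
      intro φ hφ
      rw [Finset.mem_coe, Finset.mem_image] at hφ
      obtain ⟨i, _, rfl⟩ := hφ
      exact (φi i).2)
    refine ⟨b, fun i hi => ?_⟩
    rw [hΦ, hπw]
    exact hb _ (Finset.mem_image_of_mem _ hi))
  -- a small submodel
  have wit := IsFull.wit hval hM.2.1
  choose wf hwf using wit
  let st : (HL L).Structure C :=
    { funMap := fun {n} (φ : L.BoundedFormula (Fin n) 1) xs => wf n φ xs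
      RelMap := fun {n} (r : Empty) => r.elim }
  let r : (HL L).Term I → C := fun t => t.realize w
  have hF0 : IsVal fun φ : L.Formula ((HL L).Term I) => val (φ.relabel r) := hval.relabel r
  have hW0 : Wit fun φ : L.Formula ((HL L).Term I) => val (φ.relabel r) := by
    intro n φ ys
    refine ⟨Term.func (L := HL L) (show (HL L).Functions n from φ) ys, ?_⟩
    have hr : r (Term.func (L := HL L) (show (HL L).Functions n from φ) ys) = wf n φ (r ∘ ys) := by
      change Term.realize w _ = _
      rw [Term.realize_func]
      rfl
    refine le_trans (hval.mono fun x hx => ?_) ((hwf n φ (r ∘ ys)).trans (hval.mono fun x hx => ?_))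
    · simp only [Formula.realize_relabel] at hx ⊢
      exact hx
    · rw [Formula.realize_relabel, realize_plugEmb]
      rw [realize_plugEmb] at hx
      rw [← hr] at hx
      exact hx
  obtain ⟨C0, v0, q, hq, hb0, hf0, hv0⟩ := quot hF0 hW0
  have hv0' := isVal_of_bval hb0
  have hC0 : #C0 ≤ #I := (Cardinal.mk_le_of_surjective hq).trans (card_HL hL hI le_rfl)
  let f : C0 → C := fun c => r (Function.surjInv hq c)
  have hf : ElemMap v0 val f := by
    intro φ
    have h1 := hv0 (φ.relabel (Function.surjInv hq))
    have h2 : v0 ((φ.relabel (Function.surjInv hq)).relabel q) = v0 φ := hv0'.congr fun x => by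
      simp only [Formula.realize_relabel]
      have : (x.v ∘ q) ∘ Function.surjInv hq = x.v := funext fun c => by
        simp [Function.surjInv_eq]
      rw [this]
    rw [← h2, h1]
    exact hval.congr fun x => by simp only [Formula.realize_relabel]; rfl
  have hfq : ∀ t, f (q t) = r t := by
    intro t
    by_contra hne
    have hlt := hM.1.2.2.2.2 _ _ hne
    have h1 := hf (Term.equal (Term.var (q t)) (Term.var (q (Function.surjInv hq (q t)))))
    have h3 : q (Function.surjInv hq (q t)) = q t := Function.surjInv_eq hq _
    have h4 := hv0 (Term.equal (Term.var (Function.surjInv hq (q t))) (Term.var t))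
    have h5 : v0 (Formula.relabel q (Term.equal (Term.var (Function.surjInv hq (q t))) (Term.var t)))
        = ⊤ := hv0'.valid _ fun x => by
      simp [Formula.realize_relabel, h3]
    rw [h5] at h4
    have h6 : val (Formula.relabel r (Term.equal (Term.var (Function.surjInv hq (q t))) (Term.var t)))
        = val (Term.equal (Term.var (f (q t))) (Term.var (r t))) := hval.congr fun x => by
      simp [Formula.realize_relabel, f]
    rw [← h6, ← h4] at hlt
    exact lt_irrefl _ hlt
  have hT0 : BModels v0 T := (bmodels_iff hval hf T).2 hM.2.2
  let w0 : I → C0 := fun i => q (Term.var i)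
  have hfw : ∀ i, f (w0 i) = w i := fun i => hfq _
  have hA0 : ∀ s, A0 s = v0 ((psi Φ s).relabel w0) := by
    intro s
    rw [hf]
    refine hval.congr fun x => ?_
    simp only [Formula.realize_relabel]
    rw [show (x.v ∘ f) ∘ w0 = x.v ∘ w from funext fun i => congrArg x.v (hfw i)]
  let Φ' : I → L.Formula (C0 ⊕ Unit) := fun i =>
    plugEmb (Φ i) (fun j => Sum.inl (w0 j)) fun _ => Sum.inr ()
  obtain ⟨F, hF, -, hFle⟩ := exists_val (B := B) (Set.univ : Set (World L (C0 ⊕ Unit)))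
    (fun z : L.Formula C0 × Finset I => z.1.relabel Sum.inl ⊓ fconj z.2 Φ')
    (fun z => v0 z.1 ⊓ z.2.inf a) (⊤, ∅) (by simp [hv0'.top]) (by
      rintro ⟨φ, s⟩ ⟨ψ, t⟩
      refine ⟨(φ ⊓ ψ, s ∪ t), ?_, fun x _ hx => ?_⟩
      · simp only [hv0'.inf, Finset.inf_union]
        rw [inf_inf_inf_comm]
      · simp only [Formula.realize_inf, Formula.realize_relabel, realize_fconj'] at hx ⊢
        exact ⟨⟨hx.1.1, fun i hi => hx.2 i (Finset.mem_union_left _ hi)⟩,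
          hx.1.2, fun i hi => hx.2 i (Finset.mem_union_right _ hi)⟩) (by
      rintro ⟨φ, s⟩ hne
      have hne' : v0 (φ ⊓ (psi Φ s).relabel w0) ≠ ⊥ := by
        rw [hv0'.inf, ← hA0]
        intro h0
        apply hne
        rw [eq_bot_iff, ← h0]
        exact inf_le_inf_left _ (ha s)
      obtain ⟨x, hx⟩ := hv0'.exists_world hne'
      rw [Formula.realize_inf, Formula.realize_relabel, realize_psi] at hx
      obtain ⟨hx1, y, hy⟩ := hx
      refine ⟨⟨x.N, Sum.elim x.v fun _ => y⟩, trivial, ?_⟩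
      rw [Formula.realize_inf, Formula.realize_relabel, realize_fconj']
      refine ⟨by simpa using hx1, fun i hi => ?_⟩
      rw [realize_plugEmb]
      exact hy i hi)
  have hFcons : ∀ φ : L.Formula C0, F (φ.relabel Sum.inl) = v0 φ :=
    val_conservative hv0' hF _ fun φ => by
      have := hFle (φ, ∅)
      simp only [Finset.inf_empty, inf_top_eq] at this
      refine this.trans (hF.mono fun x hx => ?_)
      exact (Formula.realize_inf.1 hx).1
  have hFa : ∀ i, a i ≤ F (Φ' i) := fun i => by
    have := hFle (⊤, {i})
    simp only [Finset.inf_singleton, hv0'.top, top_inf_eq] at this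
    refine this.trans (hF.mono fun x hx => ?_)
    have := (Formula.realize_inf.1 hx).2
    rw [realize_fconj'] at this
    exact this i (Finset.mem_singleton_self i)
  obtain ⟨C1, v1, κ, hb1, hf1, hC1, hκ⟩ := henkin hF hL hI (by
    rw [Cardinal.mk_sum, Cardinal.lift_id, Cardinal.lift_id]
    exact Cardinal.add_le_of_le hI hC0 ((Cardinal.lt_aleph0_of_finite _).le.trans hI))
  have hv1 := isVal_of_bval hb1
  have hel : ElemMap v0 v1 (fun c => κ (Sum.inl c)) := by
    intro φ
    rw [← hFcons, ← hκ]
    exact hv1.congr fun x => by simp only [Formula.realize_relabel]; rfl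
  obtain ⟨g, hg, hgι⟩ := hsat C0 C1 v0 v1 ⟨hb0, hf0, hT0⟩ ⟨hb1, hf1, (bmodels_iff hv1 hel T).1 hT0⟩ hC1
    (fun c => κ (Sum.inl c)) hel f hf
  refine ⟨π (g (κ (Sum.inr ()))), fun φ hφ => ?_⟩
  obtain ⟨i, hi⟩ := hφi ⟨φ, hφ⟩
  have h1 : val (((Φ' i).relabel κ).relabel g) ∈ U := by
    rw [← hg, hκ]
    exact hU.1.2.2.1 _ _ (haU i) (hFa i)
  rw [hπ.2, Formula.realize_relabel, Formula.realize_relabel, realize_plugEmb, hΦ, hi] at h1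
  have e1 : ((((π ∘ g) ∘ κ) ∘ fun j => Sum.inl (w0 j)) ∘ eA) = Subtype.val := by
    rw [← hπw]
    funext y
    change π (g (κ (Sum.inl (w0 (eA y))))) = π (w (eA y))
    rw [← hfw, ← hgι]
    rfl
  rw [e1] at h1
  exact h1

end MT3
end UPB

namespace UPB
section MT4
variable {L : FirstOrder.Language.{0, 0}} {B : Type} [CompleteBooleanAlgebra B] {I : Type}

/-- The elements of the saturated model. -/
inductive SY (L : FirstOrder.Language.{0, 0}) (B I : Type) : Type
  | base (i : I) : SY L B I
  | sol (G : L.Formula (I ⊕ I) → B) (f : I → SY L B I) (i : I) : SY L B I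

/-- Stages of the construction of the saturated model. -/
structure SStage (H : L.Formula I → B) (Z : Set (SY L B I)) (F : L.Formula (SY L B I) → B) : Prop where
  val : IsVal F
  base : ∀ i, SY.base i ∈ Z
  cl : ∀ G f i, SY.sol G f i ∈ Z → (∀ j, f j ∈ Z) ∧ ∀ j, SY.sol G f j ∈ Z
  ext : ∀ φ : L.Formula I, F (φ.relabel SY.base) = H φ
  sol : ∀ G f, (∀ i, SY.sol G f i ∈ Z) → IsVal G →
    (∀ φ : L.Formula I, F (φ.relabel f) = G (φ.relabel Sum.inl)) →
    ∀ φ, F (φ.relabel (Sum.elim f (SY.sol G f))) = G φ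

/-- Agreement of valuations on a set of variables. -/
def Agree {Y : Type} (Z : Set Y) (F F' : L.Formula Y → B) : Prop :=
  ∀ φ : L.Formula Z, F (φ.relabel Subtype.val) = F' (φ.relabel Subtype.val)

theorem Agree.of_range {X Y : Type} {Z : Set Y} {F F' : L.Formula Y → B} (h : Agree Z F F')
    (hF : IsVal F) (hF' : IsVal F') (f : X → Y) (hf : ∀ x, f x ∈ Z) (φ : L.Formula X) :
    F (φ.relabel f) = F' (φ.relabel f) := by
  have key : ∀ {E : L.Formula Y → B}, IsVal E → E (φ.relabel f) =
      E ((φ.relabel fun x => (⟨f x, hf x⟩ : Z)).relabel Subtype.val) := by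
    intro E hE
    refine hE.congr fun w => ?_
    simp only [Formula.realize_relabel]
    rfl
  rw [key hF, key hF']
  exact h _

theorem Agree.mono {Y : Type} {Z Z' : Set Y} {F F' : L.Formula Y → B} (h : Agree Z' F F')
    (hF : IsVal F) (hF' : IsVal F') (hZ : Z ⊆ Z') : Agree Z F F' := fun φ =>
  h.of_range hF hF' _ (fun x => hZ x.2) φ

theorem sol_inj (G : L.Formula (I ⊕ I) → B) (f : I → SY L B I) :
    Function.Injective (SY.sol G f) := fun i j h => by
  injection h

theorem base_inj : Function.Injective (SY.base : I → SY L B I) := fun i j h => by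
  injection h

theorem st_init {H : L.Formula I → B} (hH : IsVal H) :
    ∃ F, SStage H (Set.range (SY.base : I → SY L B I)) F := by
  obtain ⟨F, hF, -, hb⟩ := exists_val (B := B) (Set.univ : Set (World L (SY L B I)))
    (fun φ : L.Formula I => φ.relabel SY.base) H ⊤ hH.top (by
      intro φ ψ
      refine ⟨φ ⊓ ψ, (hH.inf _ _).ge, fun w _ h => ?_⟩
      simpa only [Formula.realize_relabel, Formula.realize_inf] using h) (by
      intro φ hφ
      obtain ⟨w, hw⟩ := hH.exists_world hφ
      refine ⟨⟨w.N, Function.extend SY.base w.v fun _ => Classical.arbitrary w.N⟩, trivial, ?_⟩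
      rw [Formula.realize_relabel, Function.extend_comp base_inj]
      exact hw)
  refine ⟨F, hF, fun i => ⟨i, rfl⟩, ?_, ?_, ?_⟩
  · rintro G f i ⟨j, hj⟩
    injection hj
  · exact val_conservative hH hF _ hb
  · intro G f hf hG hc φ
    rcases isEmpty_or_nonempty I with hI | ⟨⟨i⟩⟩
    · have h1 : F (φ.relabel (Sum.elim f (SY.sol G f))) =
        F ((φ.relabel (fun x => (hI.false (x.elim id id)).elim : I ⊕ I → I)).relabel f) :=
        hF.congr fun w => by
          simp only [Formula.realize_relabel]
          rw [Subsingleton.elim (_ ∘ _ : I ⊕ I → w.N) _]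
      rw [h1, hc]
      exact hG.congr fun w => by
          simp only [Formula.realize_relabel]
          rw [Subsingleton.elim (_ ∘ _ : I ⊕ I → w.N) _]
    · obtain ⟨j, hj⟩ := hf i
      injection hj

theorem st_step [Nonempty I] {H : L.Formula I → B} {Z F} (h : SStage H Z F) (G : L.Formula (I ⊕ I) → B)
    (f : I → SY L B I) (hf : ∀ i, f i ∈ Z) (i : I) (hi : SY.sol G f i ∉ Z) :
    ∃ F', SStage H (Z ∪ Set.range (SY.sol G f)) F' ∧ Agree Z F F' := by
  have hn : ∀ j, SY.sol G f j ∉ Z := fun j hj => hi ((h.cl _ _ _ hj).2 i)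
  obtain ⟨F', hF', hA, hS⟩ : ∃ F', IsVal F' ∧ Agree Z F F' ∧ (IsVal G →
      (∀ φ : L.Formula I, F (φ.relabel f) = G (φ.relabel Sum.inl)) →
      ∀ φ, F' (φ.relabel (Sum.elim f (SY.sol G f))) = G φ) := by
    by_cases hG : IsVal G ∧ ∀ φ : L.Formula I, F (φ.relabel f) = G (φ.relabel Sum.inl)
    swap
    · exact ⟨F, h.val, fun φ => rfl, fun h1 h2 => (hG ⟨h1, h2⟩).elim⟩
    obtain ⟨hG, hc⟩ := hG
    have hZv := h.val.relabel (Subtype.val : Z → SY L B I)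
    obtain ⟨F', hF', -, hb⟩ := exists_val (B := B) (Set.univ : Set (World L (SY L B I)))
      (fun p : L.Formula Z × L.Formula (I ⊕ I) =>
        (p.1.relabel Subtype.val ⊓ p.2.relabel (Sum.elim f (SY.sol G f)) : L.Formula (SY L B I)))
      (fun p => F (p.1.relabel Subtype.val) ⊓ G p.2) (⊤, ⊤) (by
        have := hZv.top
        simp only [hG.top, this, inf_top_eq]) (by
        rintro ⟨φ, χ⟩ ⟨φ', χ'⟩
        refine ⟨(φ ⊓ φ', χ ⊓ χ'), ?_, fun w _ hh => ?_⟩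
        · have := hZv.inf φ φ'
          simp only [hG.inf, this]
          rw [inf_inf_inf_comm]
        · simp only [Formula.realize_relabel, Formula.realize_inf] at hh ⊢
          tauto) (by
        rintro ⟨φ, χ⟩ hne
        obtain ⟨θ, hθ⟩ := ex_red χ
        have hle : G χ ≤ F (θ.relabel f) := by
          rw [hc]
          refine hG.mono fun w hw => ?_
          rw [Formula.realize_relabel, hθ]
          refine ⟨w.v ∘ Sum.inr, ?_⟩
          convert hw
          ext (x | x) <;> rfl
        have hne2 : F (φ.relabel Subtype.val ⊓ θ.relabel f) ≠ ⊥ := by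
          rw [h.val.inf]
          exact ne_bot_of_le_ne_bot hne (inf_le_inf_left _ hle)
        obtain ⟨w, hw⟩ := h.val.exists_world hne2
        rw [Formula.realize_inf, Formula.realize_relabel, Formula.realize_relabel, hθ] at hw
        obtain ⟨hw1, u, hu⟩ := hw
        have hZ : ∀ z ∈ Z, Function.extend (SY.sol G f) u w.v z = w.v z := by
          intro z hz
          rw [Function.extend_apply']
          rintro ⟨j, rfl⟩
          exact hn j hz
        refine ⟨⟨w.N, Function.extend (SY.sol G f) u w.v⟩, trivial, ?_⟩
        rw [Formula.realize_inf, Formula.realize_relabel, Formula.realize_relabel]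
        constructor
        · convert hw1 using 1
          ext z
          exact hZ z.1 z.2
        · convert hu using 1
          ext (x | x)
          · exact hZ _ (hf x)
          · exact (sol_inj G f).extend_apply _ _ x)
    refine ⟨F', hF', ?_, fun _ _ => ?_⟩
    · intro φ
      refine (val_conservative hZv hF' _ (fun φ => ?_) φ).symm
      refine le_trans ?_ ((hb (φ, ⊤)).trans (hF'.mono fun w hw => ?_))
      · simp only [hG.top, inf_top_eq, le_refl]
      · exact (Formula.realize_inf.1 hw).1
    · refine val_conservative hG hF' _ (fun φ => ?_)
      refine le_trans ?_ ((hb (⊤, φ)).trans (hF'.mono fun w hw => ?_))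
      · have := hZv.top
        simp only [this, top_inf_eq, le_refl]
      · exact (Formula.realize_inf.1 hw).2
  refine ⟨F', ⟨hF', fun j => Or.inl (h.base j), ?_, ?_, ?_⟩, hA⟩
  · rintro G' f' j (hj | ⟨k, hk⟩)
    · exact ⟨fun k => Or.inl ((h.cl _ _ _ hj).1 k), fun k => Or.inl ((h.cl _ _ _ hj).2 k)⟩
    · injection hk with h1 h2 h3
      subst h1 h2
      exact ⟨fun k => Or.inl (hf k), fun k => Or.inr ⟨k, rfl⟩⟩
  · intro φ
    rw [← h.ext]
    exact (hA.of_range h.val hF' _ h.base φ).symm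
  · intro G' f' hs hG' hc φ
    rcases hs i with hj | ⟨k, hk⟩
    · obtain ⟨h1, h2⟩ := h.cl _ _ _ hj
      rw [← hA.of_range h.val hF' _ (by rintro (x | x); exacts [h1 x, h2 x])]
      refine h.sol G' f' h2 hG' (fun ψ => ?_) φ
      rw [← hc]
      exact hA.of_range h.val hF' _ h1 ψ
    · injection hk with h1 h2 h3
      subst h1 h2
      refine hS hG' (fun ψ => ?_) φ
      rw [← hc]
      exact hA.of_range h.val hF' _ hf ψ

theorem st_chain [Nonempty I] {H : L.Formula I → B} {J : Type} [Nonempty J]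
    (Z : J → Set (SY L B I)) (F : J → L.Formula (SY L B I) → B) (h : ∀ j, SStage H (Z j) (F j))
    (hc : ∀ i j, (Z i ⊆ Z j ∧ Agree (Z i) (F i) (F j)) ∨ (Z j ⊆ Z i ∧ Agree (Z j) (F j) (F i))) :
    ∃ F', SStage H (⋃ j, Z j) F' ∧ ∀ j, Agree (Z j) (F j) F' := by
  have hZv := fun j => (h j).val.relabel (Subtype.val : Z j → SY L B I)
  obtain ⟨j0⟩ := ‹Nonempty J›
  obtain ⟨F', hF', -, hb⟩ := exists_val (B := B) (Set.univ : Set (World L (SY L B I)))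
      (fun p : Σ j, L.Formula (Z j) => p.2.relabel Subtype.val)
      (fun p => F p.1 (p.2.relabel Subtype.val)) ⟨j0, ⊤⟩ (hZv j0).top (by
        have key : ∀ i j φ ψ, Z i ⊆ Z j → Agree (Z i) (F i) (F j) → ∃ k : Σ j, L.Formula (Z j),
          F i (Formula.relabel Subtype.val (φ : L.Formula (Z i))) ⊓
            F j (Formula.relabel Subtype.val (ψ : L.Formula (Z j))) ≤ F k.1 (k.2.relabel Subtype.val) ∧
            ∀ w : World L (SY L B I), (k.2.relabel Subtype.val).Realize w.v →
            (φ.relabel Subtype.val).Realize w.v ∧ (ψ.relabel Subtype.val).Realize w.v := by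
          intro i j φ ψ hs ha
          refine ⟨⟨j, φ.relabel (Set.inclusion hs) ⊓ ψ⟩, ?_, fun w hw => ?_⟩
          · have := (hZv j).inf (φ.relabel (Set.inclusion hs)) ψ
            rw [this, ha φ]
            refine inf_le_inf_right _ ((h j).val.mono fun w hw => ?_)
            simp only [Formula.realize_relabel] at hw ⊢
            exact hw
          · simp only [Formula.realize_relabel, Formula.realize_inf] at hw ⊢
            exact hw
        rintro ⟨i, φ⟩ ⟨j, ψ⟩
        rcases hc i j with hh | hh
        · obtain ⟨k, h1, h2⟩ := key i j φ ψ hh.1 hh.2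
          exact ⟨k, h1, fun w _ => h2 w⟩
        · obtain ⟨k, h1, h2⟩ := key j i ψ φ hh.1 hh.2
          exact ⟨k, by rw [inf_comm]; exact h1, fun w _ hw => (h2 w hw).symm⟩) (by
        rintro ⟨i, φ⟩ hne
        obtain ⟨w, hw⟩ := (h i).val.exists_world hne
        exact ⟨w, trivial, hw⟩)
  have hA : ∀ j, Agree (Z j) (F j) F' := fun j φ =>
    (val_conservative (hZv j) hF' _ (fun φ => hb ⟨j, φ⟩) φ).symm
  refine ⟨F', ⟨hF', fun i => Set.mem_iUnion.2 ⟨j0, (h j0).base i⟩, ?_, ?_, ?_⟩, hA⟩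
  · intro G f i hi
    obtain ⟨j, hj⟩ := Set.mem_iUnion.1 hi
    obtain ⟨h1, h2⟩ := (h j).cl _ _ _ hj
    exact ⟨fun k => Set.mem_iUnion.2 ⟨j, h1 k⟩, fun k => Set.mem_iUnion.2 ⟨j, h2 k⟩⟩
  · intro φ
    rw [← (h j0).ext]
    exact ((hA j0).of_range (h j0).val hF' _ (h j0).base φ).symm
  · intro G f hs hG hc φ
    obtain ⟨j, hj⟩ := Set.mem_iUnion.1 (hs (Classical.arbitrary I))
    obtain ⟨h1, h2⟩ := (h j).cl _ _ _ hj
    rw [← (hA j).of_range (h j).val hF' _ (by rintro (x | x); exacts [h1 x, h2 x])]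
    refine (h j).sol G f h2 hG (fun ψ => ?_) φ
    rw [← hc]
    exact (hA j).of_range (h j).val hF' _ h1 ψ

theorem exists_sat [Nonempty I] {H : L.Formula I → B} (hH : IsVal H) :
    ∃ F : L.Formula (SY L B I) → B, IsVal F ∧ (∀ φ : L.Formula I, F (φ.relabel SY.base) = H φ) ∧
      ∀ (G : L.Formula (I ⊕ I) → B) (f : I → SY L B I), IsVal G →
        (∀ φ : L.Formula I, F (φ.relabel f) = G (φ.relabel Sum.inl)) →
        ∃ g : I → SY L B I, ∀ φ, F (φ.relabel (Sum.elim f g)) = G φ := by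
  let S := {p : Set (SY L B I) × (L.Formula (SY L B I) → B) // SStage H p.1 p.2}
  let r : S → S → Prop := fun p q => p.1.1 ⊆ q.1.1 ∧ Agree p.1.1 p.1.2 q.1.2
  haveI : Nonempty S := by
    obtain ⟨F, hF⟩ := st_init hH
    exact ⟨⟨(_, F), hF⟩⟩
  obtain ⟨m, hm⟩ := exists_maximal_of_nonempty_chains_bounded (r := r) (by
    intro c hc hne
    haveI : Nonempty c := hne.to_subtype
    obtain ⟨F', h1, h2⟩ := st_chain (fun p : c => p.1.1.1) (fun p : c => p.1.1.2) (fun p => p.1.2) (by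
      intro i j
      by_cases hij : i = j
      · subst hij
        exact Or.inl ⟨le_rfl, fun φ => rfl⟩
      · exact hc i.2 j.2 (fun h => hij (Subtype.ext h)))
    exact ⟨⟨(_, F'), h1⟩, fun a ha => ⟨Set.subset_iUnion (fun p : c => p.1.1.1) ⟨a, ha⟩, h2 ⟨a, ha⟩⟩⟩) (by
    rintro a b c ⟨h1, h2⟩ ⟨h3, h4⟩
    exact ⟨h1.trans h3, fun φ => (h2 φ).trans ((h4.mono b.2.val c.2.val h1) φ)⟩)
  have hall : ∀ y, y ∈ m.1.1 := by
    intro y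
    induction y with
    | base i => exact m.2.base i
    | sol G f i ih =>
      by_contra hi
      obtain ⟨F', h1, h2⟩ := st_step m.2 G f ih i hi
      exact hi ((hm ⟨(_, F'), h1⟩ ⟨Set.subset_union_left, h2⟩).1 (Or.inr ⟨i, rfl⟩))
  exact ⟨m.1.2, m.2.val, m.2.ext, fun G f hG hc =>
    ⟨SY.sol G f, m.2.sol G f (fun i => hall _) hG hc⟩⟩

end MT4
end UPB

namespace UPB
section MT5
variable {L : FirstOrder.Language.{0, 0}} {B : Type} [CompleteBooleanAlgebra B] {I : Type}

theorem IsVal.rel_comp {X Y Z : Type} {F : L.Formula Z → B} (hF : IsVal F) (f : X → Y) (g : Y → Z)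
    (φ : L.Formula X) : F ((φ.relabel f).relabel g) = F (φ.relabel (g ∘ f)) :=
  hF.congr fun w => by simp only [Formula.realize_relabel]; rfl

/-- The solution property. -/
def SatStar {Y : Type} (I : Type) (F : L.Formula Y → B) : Prop :=
  ∀ (G : L.Formula (I ⊕ I) → B) (f : I → Y), IsVal G →
    (∀ φ : L.Formula I, F (φ.relabel f) = G (φ.relabel Sum.inl)) →
    ∃ g : I → Y, ∀ φ, F (φ.relabel (Sum.elim f g)) = G φ

theorem SatStar.wit [Infinite I] {Y : Type} [Nonempty Y] {F : L.Formula Y → B} (hF : IsVal F)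
    (hs : SatStar I F) : Wit F := by
  intro n φ ys
  let e : Fin n → I := fun k => Infinite.natEmbedding I k
  have he : Function.Injective e := fun a b h =>
    Fin.ext ((Infinite.natEmbedding I).injective h)
  let i0 : I := Classical.arbitrary I
  let f : I → Y := Function.extend e ys fun _ => Classical.arbitrary Y
  have hfe : f ∘ e = ys := Function.extend_comp he _ _
  let χ : L.Formula (I ⊕ I) := plugEmb φ (Sum.inl ∘ e) fun _ => Sum.inr i0
  let η : L.Formula I := Formula.relabel e (φ.ex : L.Formula (Fin n))
  have hFv := hF.relabel f
  obtain ⟨G, hG, -, hb⟩ := exists_val (B := B) (Set.univ : Set (World L (I ⊕ I)))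
    (fun ψ : L.Formula I => (ψ.relabel Sum.inl ⊓ ((η.relabel Sum.inl).imp χ) : L.Formula (I ⊕ I)))
    (fun ψ => F (ψ.relabel f)) ⊤ hFv.top (by
      intro ψ ψ'
      refine ⟨ψ ⊓ ψ', (hFv.inf _ _).ge, fun w _ h => ?_⟩
      simp only [Formula.realize_relabel, Formula.realize_inf] at h ⊢
      tauto) (by
      intro ψ hψ
      obtain ⟨w, hw⟩ := hFv.exists_world hψ
      by_cases hx : ∃ x, φ.Realize (w.v ∘ e) fun _ => x
      · obtain ⟨x, hx⟩ := hx
        refine ⟨⟨w.N, Sum.elim w.v fun _ => x⟩, trivial, ?_⟩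
        rw [Formula.realize_inf, Formula.realize_relabel, Formula.realize_imp]
        refine ⟨hw, fun _ => ?_⟩
        rw [realize_plugEmb]
        exact hx
      · refine ⟨⟨w.N, Sum.elim w.v fun _ => Classical.arbitrary w.N⟩, trivial, ?_⟩
        rw [Formula.realize_inf, Formula.realize_relabel, Formula.realize_imp]
        refine ⟨hw, fun h => (hx ?_).elim⟩
        rw [Formula.realize_relabel, Formula.realize_relabel, realize_ex1] at h
        exact h)
  have hc : ∀ φ : L.Formula I, F (φ.relabel f) = G (φ.relabel Sum.inl) := fun ψ =>
    (val_conservative hFv hG Sum.inl (fun ψ => (hb ψ).trans (hG.mono fun w hw =>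
      (Formula.realize_inf.1 hw).1)) ψ).symm
  obtain ⟨g, hg⟩ := hs G f hG hc
  refine ⟨g i0, ?_⟩
  have h1 : F (Formula.relabel ys (φ.ex : L.Formula (Fin n))) = F (η.relabel f) := by
    rw [hF.rel_comp, hfe]
  have h2 : F (plugEmb φ ys fun _ => g i0) = F (χ.relabel (Sum.elim f g)) := by
    refine hF.congr fun w => ?_
    rw [realize_plugEmb, Formula.realize_relabel, realize_plugEmb, ← hfe]
    rfl
  rw [h1, h2, hc, hg]
  refine hG.le_of_worlds fun w hw hw' => ?_
  have htop : G ((⊤ : L.Formula I).relabel Sum.inl ⊓ ((η.relabel Sum.inl).imp χ)) = ⊤ := by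
    rw [eq_top_iff, ← hFv.top]
    exact hb ⊤
  exact Formula.realize_imp.1 (Formula.realize_inf.1 (hw _ htop)).2 hw'

theorem SatStar.bsat [Infinite I] {Y C : Type} {F : L.Formula Y → B} (hF : IsVal F)
    (hs : SatStar I F) {val : L.Formula C → B} {q : Y → C} (hq : Function.Surjective q)
    (hv : IsBVal val) (hqF : ∀ φ : L.Formula Y, val (φ.relabel q) = F φ) (T : L.Theory) :
    BSaturated T #I val := by
  intro C0 C1 v0 v1 h0 h1 hcard ι hι f hf
  have hval := isVal_of_bval hv
  have hv0 := isVal_of_bval h0.1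
  have hv1 := isVal_of_bval h1.1
  have hinj : Function.Injective ι := by
    intro a b hab
    by_contra hne
    have := h0.1.2.2.2.2 a b hne
    rw [hι] at this
    apply this.ne
    refine hv1.valid _ fun w => ?_
    rw [Formula.realize_relabel]
    simp [hab]
  have hcard0 : #C0 ≤ #I := (Cardinal.mk_le_of_injective hinj).trans hcard
  obtain ⟨c0, -⟩ := h0.2.1 ⊤
  haveI : Nonempty C0 := ⟨c0⟩
  haveI : Nonempty C1 := ⟨ι c0⟩
  obtain ⟨e0⟩ := hcard0
  obtain ⟨e1⟩ := hcard
  have hs0 : Function.LeftInverse (Function.invFun e0) e0 := Function.leftInverse_invFun e0.injective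
  have hs1 : Function.LeftInverse (Function.invFun e1) e1 := Function.leftInverse_invFun e1.injective
  generalize Function.invFun e0 = s0 at hs0
  generalize Function.invFun e1 = s1 at hs1
  let t : C → Y := Function.surjInv hq
  have hqt : ∀ c, q (t c) = c := Function.surjInv_eq hq
  obtain ⟨g, hg⟩ := hs (fun φ => v1 (φ.relabel (Sum.elim (ι ∘ s0) s1))) (fun i => t (f (s0 i)))
    (hv1.relabel _) (by
      intro φ
      rw [← hqF, hval.rel_comp, hv1.rel_comp]
      have e2 : (q ∘ fun i => t (f (s0 i))) = f ∘ s0 := funext fun i => hqt _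
      rw [e2, ← hval.rel_comp, ← hf, hι, hv1.rel_comp]
      rfl)
  have hG : ∀ {X : Type} (φ : L.Formula X) (k : X → I ⊕ I),
      val (φ.relabel (q ∘ Sum.elim (fun i => t (f (s0 i))) g ∘ k)) =
      v1 (φ.relabel (Sum.elim (ι ∘ s0) s1 ∘ k)) := by
    intro X φ k
    rw [← hv1.rel_comp, ← hg, ← hval.rel_comp, hqF, hF.rel_comp]
  refine ⟨fun c => q (g (e1 c)), fun φ => ?_, funext fun c => ?_⟩
  · have := hG φ fun c => Sum.inr (e1 c)
    have e3 : (Sum.elim (ι ∘ s0) s1 ∘ fun c => Sum.inr (e1 c)) = id := funext fun c => hs1 c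
    rw [e3] at this
    have e4 : v1 (φ.relabel id) = v1 φ := hv1.congr fun w => by
      rw [Formula.realize_relabel]; rfl
    rw [e4] at this
    rw [← this]
    rfl
  · by_contra hne
    have h3 := hv.2.2.2.2 _ _ hne
    apply h3.ne
    have h4 := hG (Term.equal (Term.var true) (Term.var false) : L.Formula Bool)
      (fun b => if b then Sum.inr (e1 (ι c)) else Sum.inl (e0 c))
    have h5 : v1 ((Term.equal (Term.var true) (Term.var false) : L.Formula Bool).relabel
      (Sum.elim (ι ∘ s0) s1 ∘ fun b => if b then Sum.inr (e1 (ι c)) else Sum.inl (e0 c))) = ⊤ := by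
      refine hv1.valid _ fun w => ?_
      rw [Formula.realize_relabel]
      simp [hs0 c, hs1 (ι c)]
    rw [h5] at h4
    rw [← h4]
    refine hval.congr fun w => ?_
    rw [Formula.realize_relabel]
    simp [hs0 c, hqt]

theorem mt_forth [Infinite I] {U : Set B} (hU : IsBUltrafilter U) (T : L.Theory)
    (hsat : Saturates U T #I) (Φ : I → L.BoundedFormula I 1) (A : Finset I → B)
    (hA : Compat (QT T Φ) A) (hAU : ∀ s, A s ∈ U) : HasMR U A := by
  classical
  obtain ⟨H, hH, hHT, hb⟩ := exists_val (B := B) {w : World L I | w.N ⊨ T}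
    (fun p : Pat I => (fconj p.1 (psi Φ) ⊓ fconj p.2 (fun s => (psi Φ s).not) : L.Formula I))
    (pval A) (∅, ∅) (by simp [pval]) (by
      rintro ⟨p, q⟩ ⟨p', q'⟩
      refine ⟨(p ∪ p', q ∪ q'), ?_, fun w _ h => ?_⟩
      · simp only [pval, Finset.inf_union]
        rw [inf_inf_inf_comm]
      · simp only [Formula.realize_inf, realize_fconj', Finset.mem_union] at h ⊢
        exact ⟨⟨fun i hi => h.1 i (Or.inl hi), fun i hi => h.2 i (Or.inl hi)⟩,
          ⟨fun i hi => h.1 i (Or.inr hi), fun i hi => h.2 i (Or.inr hi)⟩⟩) (by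
      intro p hp
      by_cases hQ : p ∈ QT T Φ
      · obtain ⟨w, h1, h2, h3⟩ := hQ
        refine ⟨w, h1, ?_⟩
        simp only [Formula.realize_inf, realize_fconj', Formula.realize_not]
        exact ⟨h2, h3⟩
      · exact (hp (hA p hQ)).elim)
  have hHA : ∀ s, H (psi Φ s) = A s := by
    intro s
    apply le_antisymm
    · have h1 := (hb (∅, {s})).trans (hH.mono (ψ := (psi Φ s).not) fun w hw => by
        simp only [Formula.realize_inf, realize_fconj'] at hw
        exact hw.2 s (Finset.mem_singleton_self s))
      simp only [pval, Finset.inf_empty, Finset.inf_singleton, top_inf_eq, hH.not] at h1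
      exact compl_le_compl_iff_le.mp h1
    · have h1 := (hb ({s}, ∅)).trans (hH.mono (ψ := psi Φ s) fun w hw => by
        simp only [Formula.realize_inf, realize_fconj'] at hw
        exact hw.1 s (Finset.mem_singleton_self s))
      simpa only [pval, Finset.inf_empty, Finset.inf_singleton, inf_top_eq] using h1
  obtain ⟨F, hF, hFH, hsol⟩ := exists_sat hH
  have hss : SatStar I F := hsol
  haveI : Nonempty (SY L B I) := ⟨SY.base (Classical.arbitrary I)⟩
  obtain ⟨C, val, q, hq, hv, hfull, hqF⟩ := quot hF (hss.wit hF)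
  have hval := isVal_of_bval hv
  have hT : BModels val T := by
    rw [← bmodels_iff hval (fun φ => (hqF φ).symm : ElemMap F val q),
      ← bmodels_iff hF (fun φ => (hFH φ).symm : ElemMap H F SY.base)]
    intro φ hφ
    exact hHT _ fun w hw => of_model w hw φ hφ
  obtain ⟨N, strN, π, hπ⟩ := exists_spec hval hfull hU
  have hN := hsat C val ⟨hv, hfull, hT⟩ (hss.bsat hF hq hv hqF T) N π hπ
  let w : I → C := q ∘ SY.base
  have hvA : ∀ s, val ((psi Φ s).relabel w) = A s := by
    intro s
    rw [← hval.rel_comp, hqF, hFH, hHA]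
  let P : Set N := Set.range (π ∘ w)
  let Φ' : I → L.BoundedFormula P 1 := fun i => (Φ i).subst fun j => Term.var ⟨π (w j), ⟨j, rfl⟩⟩
  have hΦ' : ∀ i (x : N), (Φ' i).Realize Subtype.val (fun _ => x) ↔ (Φ i).Realize (π ∘ w) fun _ => x := by
    intro i x
    exact BoundedFormula.realize_subst
  obtain ⟨x, hx⟩ := hN P Cardinal.mk_range_le (Set.range Φ') (by
    intro s hs
    choose! idx hidx using hs
    have h1 := hAU (s.image idx)
    rw [← hvA, hπ.2, Formula.realize_relabel, realize_psi] at h1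
    obtain ⟨x, hx⟩ := h1
    refine ⟨x, fun φ hφ => ?_⟩
    rw [← hidx hφ, hΦ']
    exact hx _ (Finset.mem_image_of_mem _ hφ))
  obtain ⟨c, rfl⟩ := hπ.1 x
  refine ⟨fun i => val (plugEmb (Φ i) w fun _ => c), fun i => ?_, fun s => ?_⟩
  · rw [hπ.2, realize_plugEmb]
    exact (hΦ' i _).1 (hx _ ⟨i, rfl⟩)
  · rw [← hval.conj, ← hvA]
    refine hval.mono fun x hx => ?_
    rw [realize_fconj'] at hx
    rw [Formula.realize_relabel, realize_psi]
    refine ⟨x.v c, fun i hi => ?_⟩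
    have := hx i hi
    rw [realize_plugEmb] at this
    exact this

end MT5
end UPB

namespace UPB
section Fin
variable {B : Type} [CompleteBooleanAlgebra B] {I : Type}

/-- Indexed partitions of unity. -/
structure IsPart (e : I → B) : Prop where
  ne : ∀ i, e i ≠ ⊥
  disj : ∀ i j, i ≠ j → e i ⊓ e j = ⊥
  sup : ⨆ i, e i = ⊤

theorem exists_part [Nonempty I] (h : ∃ S : Set B, IsBAntichain S ∧ #S = #I) : ∃ e : I → B, IsPart e := by
  classical
  obtain ⟨S, hS, hc⟩ := h
  obtain ⟨eq⟩ := Cardinal.eq.mp hc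
  let u : I → B := fun i => (eq.symm i).1
  have hne : ∀ i, u i ≠ ⊥ := fun i => hS.1 _ (eq.symm i).2
  have hd : ∀ i j, i ≠ j → u i ⊓ u j = ⊥ := fun i j hij =>
    hS.2 (eq.symm i).2 (eq.symm j).2 fun h => hij (eq.symm.injective (Subtype.ext h))
  obtain ⟨i0⟩ := ‹Nonempty I›
  let c : B := ⨆ (j) (_ : j ≠ i0), u j
  have hle : ∀ j, j ≠ i0 → u j ≤ c := fun j hj => le_iSup₂_of_le j hj le_rfl
  refine ⟨fun i => if i = i0 then cᶜ else u i, ⟨fun i => ?_, fun i j hij => ?_, ?_⟩⟩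
  · by_cases hi : i = i0
    · simp only [hi, if_true]
      refine ne_bot_of_le_ne_bot (hne i0) ?_
      rw [le_compl_iff_disjoint_right, disjoint_iff]
      simp only [c, inf_iSup_eq, iSup_eq_bot]
      exact fun j hj => hd _ _ hj.symm
    · simp only [hi, if_false]
      exact hne i
  · by_cases hi : i = i0
    · have hj : j ≠ i0 := fun h => hij (hi.trans h.symm)
      simp only [hi, if_true, hj, if_false]
      rw [← disjoint_iff]
      exact (disjoint_compl_left).mono_right (hle j hj)
    · by_cases hj : j = i0
      · simp only [hi, if_false, hj, if_true]
        rw [← disjoint_iff]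
        exact (disjoint_compl_right).mono_left (hle i hi)
      · simp only [hi, if_false, hj]
        exact hd i j hij
  · rw [eq_top_iff, ← compl_sup_eq_top (x := c)]
    refine sup_le (le_iSup_of_le i0 (by simp)) (iSup₂_le fun j hj => le_iSup_of_le j (by simp [hj]))

/-- Gluing along a partition. -/
def glue (e : I → B) (X : Set I) (c : I → B) : B := ⨆ β ∈ X, e β ⊓ c β

namespace IsPart
variable {e : I → B}

theorem le (he : IsPart e) {x y : B} (h : ∀ i, e i ⊓ x ≤ y) : x ≤ y := by
  rw [← top_inf_eq x, ← he.sup, iSup_inf_eq]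
  exact iSup_le h

theorem glue_le (he : IsPart e) (X : Set I) (c : I → B) (i : I) : e i ⊓ glue e X c ≤ c i := by
  rw [glue]
  simp only [inf_iSup_eq]
  refine iSup₂_le fun j hj => ?_
  by_cases hij : i = j
  · subst hij
    exact inf_le_right.trans inf_le_right
  · rw [← inf_assoc, he.disj i j hij, bot_inf_eq]
    exact bot_le

theorem glue_bot (he : IsPart e) {X : Set I} (c : I → B) {i : I} (hi : i ∉ X) :
    e i ⊓ glue e X c = ⊥ := by
  rw [glue]
  simp only [inf_iSup_eq, iSup_eq_bot]
  intro j hj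
  have hij : i ≠ j := fun h => hi (h ▸ hj)
  rw [← inf_assoc, he.disj i j hij, bot_inf_eq]

theorem le_glue (X : Set I) (c : I → B) {i : I} (hi : i ∈ X) : e i ⊓ c i ≤ glue e X c :=
  le_iSup₂_of_le i hi le_rfl

/-- The power set embeds. -/
theorem hom (he : IsPart e) : IsHom fun X : Set I => glue e X fun _ => ⊤ := by
  have h1 : ∀ {X : Set I} {i}, i ∈ X → e i ≤ glue e X fun _ => ⊤ := fun {X i} hi => by
    simpa using le_glue (e := e) X (fun _ => ⊤) hi
  have h2 : ∀ {X : Set I} {i}, i ∉ X → e i ⊓ glue e X (fun _ => ⊤) = ⊥ := fun hi => he.glue_bot _ hi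
  refine ⟨fun X Y => le_antisymm ?_ ?_, fun X => ?_, ?_⟩
  · refine he.le fun i => ?_
    by_cases hi : i ∈ X ⊓ Y
    · exact inf_le_left.trans (le_inf (h1 hi.1) (h1 hi.2))
    · rw [h2 hi]; exact bot_le
  · refine he.le fun i => ?_
    by_cases hi : i ∈ X
    · by_cases hi' : i ∈ Y
      · exact inf_le_left.trans (h1 ⟨hi, hi'⟩)
      · exact (inf_le_inf_left _ inf_le_right).trans ((h2 hi').trans_le bot_le)
    · exact (inf_le_inf_left _ inf_le_left).trans ((h2 hi).trans_le bot_le)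
  · refine (IsCompl.compl_eq (IsCompl.of_eq ?_ ?_)).symm
    · rw [eq_bot_iff]
      refine he.le fun i => ?_
      by_cases hi : i ∈ X
      · exact (inf_le_inf_left _ inf_le_right).trans ((h2 (X := Xᶜ) (fun h => h hi)).trans_le bot_le)
      · exact (inf_le_inf_left _ inf_le_left).trans ((h2 hi).trans_le bot_le)
    · rw [eq_top_iff]
      refine he.le fun i => inf_le_left.trans ?_
      by_cases hi : i ∈ X
      · exact (h1 hi).trans le_sup_left
      · exact (h1 (X := Xᶜ) hi).trans le_sup_right
  · rw [eq_top_iff]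
    exact he.le fun i => inf_le_left.trans (h1 trivial)

end IsPart

theorem compat_mono {L : FirstOrder.Language.{0, 0}} {T : L.Theory} {Φ : I → L.BoundedFormula I 1}
    {A : Finset I → B} (h : Compat (QT T Φ) A) {s t : Finset I} (hst : s ⊆ t) : A t ≤ A s := by
  have := h ({t}, {s}) (by
    rintro ⟨w, -, h1, h2⟩
    have h3 := h1 t (Finset.mem_singleton_self t)
    apply h2 s (Finset.mem_singleton_self s)
    rw [realize_psi] at h3 ⊢
    obtain ⟨x, hx⟩ := h3
    exact ⟨x, fun i hi => hx i (hst hi)⟩)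
  simp only [pval, Finset.inf_singleton] at this
  rwa [← disjoint_iff, disjoint_compl_right_iff] at this

theorem compat_empty {L : FirstOrder.Language.{0, 0}} {T : L.Theory} {Φ : I → L.BoundedFormula I 1}
    {A : Finset I → B} (h : Compat (QT T Φ) A) : A ∅ = ⊤ := by
  have := h (∅, {∅}) (by
    rintro ⟨w, -, h1, h2⟩
    apply h2 ∅ (Finset.mem_singleton_self _)
    rw [realize_psi]
    exact ⟨Classical.arbitrary _, fun i hi => by simp at hi⟩)
  simpa only [pval, Finset.inf_singleton, Finset.inf_empty, top_inf_eq, compl_eq_bot] using this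

theorem HasMR.hom {B' : Type} [CompleteBooleanAlgebra B'] {F : B → B'} (hF : IsHom F) {U : Set B'}
    {A : Finset I → B} (h : HasMR {b | F b ∈ U} A) : HasMR U fun s => F (A s) := by
  obtain ⟨a, h1, h2⟩ := h
  exact ⟨fun i => F (a i), h1, fun s => by rw [← hF.finset_inf]; exact hF.mono (h2 s)⟩

theorem main [Infinite I] (B0 B1 : Type) [CompleteBooleanAlgebra B0] [CompleteBooleanAlgebra B1]
    (hanti : ∃ S : Set B0, IsBAntichain S ∧ #S = #I)
    (hcc : ∀ κ : Cardinal, κ < ccOf B1 → (2 : Cardinal) ^ κ ≤ (2 : Cardinal) ^ #I)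
    (U1 : Set B1) (hU1 : IsBUltrafilter U1) :
    ∃ U0 : Set B0, IsBUltrafilter U0 ∧ (∃ a : I → B0, IsRegularFamily a ∧ ∀ i, a i ∈ U0) ∧
      ∀ (L : FirstOrder.Language.{0, 0}), L.card ≤ ℵ₀ →
        ∀ T : L.Theory, (Saturates U0 T #I ↔ Saturates U1 T #I) := by
  classical
  obtain ⟨e, he⟩ := exists_part hanti
  choose V hV heV using fun i => exists_ult (e i) (he.ne i)
  let h : B0 → Set I := fun b => {i | b ∈ V i}
  have hh : IsHom h := isHom_ult V hV
  let k : Set I → B0 := fun X => glue e X fun _ => ⊤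
  have hk : IsHom k := he.hom
  have hhk : ∀ X, h (k X) = X := by
    intro X
    ext i
    change k X ∈ V i ↔ i ∈ X
    constructor
    · intro hi
      by_contra hX
      have := (hV i).1.2.2.2 _ _ (heV i) hi
      rw [he.glue_bot _ hX] at this
      exact (hV i).1.2.1 this
    · intro hi
      refine (hV i).1.2.2.1 _ _ (heV i) ?_
      simpa using IsPart.le_glue (e := e) X (fun _ => ⊤) hi
  let Bad : Set (Pat I) → (Finset I → B1) → Prop := fun Q A =>
    Compat Q A ∧ (∀ s, A s ∈ U1) ∧ ¬ HasMR U1 A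
  let Cd : Set (Pat I) → Finset I → B1 := fun Q =>
    if hQ : ∃ A, Bad Q A then hQ.choose else fun _ => ⊤
  have hCd : ∀ Q, (∃ A, Bad Q A) → Bad Q (Cd Q) := by
    intro Q hQ
    simp only [Cd, hQ, dif_pos]
    exact hQ.choose_spec
  obtain ⟨j, hj, hj1, hj2⟩ := thmX hcc U1 hU1 Cd
  have hjh : IsHom fun b => j (h b) := hj.comp hh
  have hU0 : IsBUltrafilter {b : B0 | j (h b) ∈ U1} := ult_pull hjh hU1
  refine ⟨_, hU0, ?_, fun L hL T => ⟨fun hs => ?_, fun hs => ?_⟩⟩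
  · obtain ⟨Bf, hfin, -, hBU⟩ := hj1 (fun _ => Set.univ) (fun _ _ _ => le_rfl) rfl
      ⟨fun _ => ⊤, fun _ => hU1.1.1, fun s => by
        rw [show (Set.univ : Set I) = ⊤ from rfl, hj.top]; exact le_top⟩
    have hmem : ∀ i, k (Bf i) ∈ {b : B0 | j (h b) ∈ U1} := fun i => by
      change j (h (k (Bf i))) ∈ U1
      rw [hhk]
      exact hBU i
    refine ⟨fun i => k (Bf i), ⟨⟨fun s h0 => ?_, fun J _ hJ => ?_⟩, fun b hb => ?_⟩, hmem⟩
    · have := (ult_finset hU0 s fun i => k (Bf i)).2 fun i _ => hmem i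
      rw [h0] at this
      exact hU0.1.2.1 this
    · rw [eq_bot_iff]
      refine he.le fun α => ?_
      obtain ⟨i, hi, hα⟩ : ∃ i ∈ J, α ∉ Bf i := by
        by_contra hcon
        push Not at hcon
        exact hJ ((hfin α).subset hcon)
      refine (inf_le_inf_left _ (iInf₂_le i hi)).trans ?_
      exact (he.glue_bot _ hα).le
    · obtain ⟨α, hα⟩ : ∃ α, e α ⊓ b ≠ ⊥ := by
        by_contra hcon
        push Not at hcon
        exact hb (eq_bot_iff.2 (he.le fun i => (hcon i).le))
      refine ⟨e α ⊓ b, hα, inf_le_right, fun i => ?_⟩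
      by_cases hi : α ∈ Bf i
      · left
        refine inf_le_left.trans ?_
        simpa using IsPart.le_glue (e := e) (Bf i) (fun _ => ⊤) hi
      · right
        refine inf_le_left.trans ?_
        rw [le_compl_iff_disjoint_right, disjoint_iff]
        exact he.glue_bot _ hi
  · refine mt_back hL T hU1 fun Φ A hA hAU => ?_
    by_contra hno
    obtain ⟨h1, h2, h3⟩ := hCd (QT T Φ) ⟨A, hA, hAU, hno⟩
    obtain ⟨f, hf, hjf⟩ := hj2 (QT T Φ)
    have hkf : IsHom fun b => k (f b) := hk.comp hf
    have hb : ∀ s, j (h (k (f (Cd (QT T Φ) s)))) = Cd (QT T Φ) s := fun s => by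
      rw [hhk, hjf]
    have hmr := mt_forth hU0 T hs Φ (fun s => k (f (Cd (QT T Φ) s))) (h1.hom hkf) (fun s => by
      change j (h (k (f (Cd (QT T Φ) s)))) ∈ U1
      rw [hb]
      exact h2 s)
    have := HasMR.hom hjh hmr
    simp only [hb] at this
    exact h3 this
  · refine mt_back hL T hU0 fun Φ A hA hAU => ?_
    have hmr := mt_forth hU1 T hs Φ (fun s => j (h (A s))) (hA.hom hjh) hAU
    obtain ⟨Bf, hfin, hsub, hBU⟩ := hj1 (fun s => h (A s)) (fun s t hst => hh.mono (compat_mono hA hst))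
      (by
        change h (A ∅) = _
        rw [compat_empty hA, hh.top]
        rfl) hmr
    let sα : I → Finset I := fun α => (hfin α).toFinset
    refine ⟨fun i => glue e (Bf i) fun α => A (sα α), fun i => ?_, fun s => ?_⟩
    · change j (h _) ∈ U1
      refine hU1.1.2.2.1 _ _ (hBU i) (hj.mono ?_)
      intro α hα
      have h1 : A (sα α) ∈ V α := by
        refine hsub (sα α) ?_
        simp only [Set.mem_iInter]
        intro i' hi'
        simpa [sα] using hi'
      exact (hV α).1.2.2.1 _ _ ((hV α).1.2.2.2 _ _ (heV α) h1) (IsPart.le_glue (e := e) (Bf i) (fun α => A (sα α)) hα)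
    · refine he.le fun α => ?_
      by_cases hs : ∀ i ∈ s, α ∈ Bf i
      · rcases s.eq_empty_or_nonempty with rfl | ⟨i, hi⟩
        · rw [compat_empty hA]; exact le_top
        · refine (inf_le_inf_left _ (Finset.inf_le hi)).trans ((he.glue_le _ _ α).trans ?_)
          refine compat_mono hA fun i' hi' => ?_
          simpa [sα] using hs i' hi'
      · push Not at hs
        obtain ⟨i, hi, hα⟩ := hs
        refine (inf_le_inf_left _ (Finset.inf_le hi)).trans ?_
        rw [he.glue_bot _ hα]
        exact bot_le

end Fin
end UPB

/-- **Ultrafilter pullbacks** (Theorem 7.1). -/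
theorem stmt17_ultrafilter_pullbacks (lam : Cardinal) (hlam : ℵ₀ ≤ lam)
    (B0 B1 : Type) [CompleteBooleanAlgebra B0] [CompleteBooleanAlgebra B1]
    (hanti : ∃ S : Set B0, IsBAntichain S ∧ Cardinal.mk ↥S = lam)
    (hcc : ∀ κ : Cardinal, κ < ccOf B1 → (2 : Cardinal) ^ κ ≤ (2 : Cardinal) ^ lam)
    (U1 : Set B1) (hU1 : IsBUltrafilter U1) :
    ∃ U0 : Set B0, IsBUltrafilter U0 ∧ IsRegularFilter U0 lam ∧
      ∀ (L : FirstOrder.Language.{0, 0}), L.card ≤ ℵ₀ →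
        ∀ T : L.Theory, T.IsComplete →
          (Saturates U0 T lam ↔ Saturates U1 T lam) := by
  have hI : #(Quotient.out lam) = lam := Cardinal.mk_out lam
  have : Infinite (Quotient.out lam) := by
    rw [Cardinal.infinite_iff, hI]
    exact hlam
  obtain ⟨U0, h1, h2, h3⟩ := UPB.main (I := Quotient.out lam) B0 B1 (by rw [hI]; exact hanti)
    (by rw [hI]; exact hcc) U1 hU1
  rw [hI] at h3
  exact ⟨U0, h1, h2, fun L hL T _ => h3 L hL T⟩
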